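/- Let T be a C_{2,ϖ} orientation-preserving circle diffeomorphism whose irrational rotation number ρ = [k₁,k₂,…] is of constant type, i.e. supₙ kₙ < ∞. If ϖ satisfies the Dini condition ∫₀¹ ϖ(y)/y dy < +∞, then T admits a C¹ conjugacy to the rigid rotation R_ρ. -/

import Mathlib

/-- A modulus of continuity. -/
structure IsModulus (w : ℝ → ℝ) : Prop where
  pos : ∀ x : ℝ, 0 < x → 0 < w x
  strictMono : StrictMonoOn w (Set.Ioi 0)
  continuous : ContinuousOn w (Set.Ioi 0)
  subadd : ∀ x y : ℝ, 0 < x → 0 < y → w (x + y) ≤ w x + w y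
  tendsto : Filter.Tendsto w (nhdsWithin 0 (Set.Ioi 0)) (nhds 0)

section

open Filter Set MeasureTheory Topology

/-- A lift of an orientation-preserving circle homeomorphism with irrational rotation number. -/
structure IrrationalLift (F : ℝ → ℝ) (ρ : ℝ) : Prop where
  strictMono : StrictMono F
  map_add_one : ∀ x, F (x + 1) = F x + 1
  irrational : Irrational ρ
  tendsto : ∀ x, Tendsto (fun n : ℕ => (F^[n] x - x) / (n : ℝ)) atTop (𝓝 ρ)

/-- The point `F^m x - a` of the lifted orbit of `x`. -/
def orbitPt (F : ℝ → ℝ) (m : ℕ) (a : ℤ) (x : ℝ) : ℝ := F^[m] x - a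

namespace IrrationalLift

variable {F : ℝ → ℝ} {ρ : ℝ}

theorem iterate_sub_int (h : IrrationalLift F ρ) (n : ℕ) (x : ℝ) (a : ℤ) :
    F^[n] (x - a) = F^[n] x - a := by
  have h1 : ∀ x (b : ℕ), F (x + b) = F x + b := by
    intro x b
    induction b with
    | zero => simp
    | succ b ih => push_cast; rw [← add_assoc, h.map_add_one, ih, add_assoc]
  have h2 : ∀ x, F (x - a) = F x - a := by
    intro x
    obtain ⟨b, rfl | rfl⟩ := a.eq_nat_or_neg
    · have := h1 (x - b) b
      rw [sub_add_cancel] at this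
      simp [this]
    · simpa using h1 x b
  induction n generalizing x with
  | zero => rfl
  | succ n ih => rw [Function.iterate_succ_apply, h2, ih, Function.iterate_succ_apply]

theorem strictMono_iterate (h : IrrationalLift F ρ) (n : ℕ) : StrictMono F^[n] :=
  h.strictMono.iterate n

theorem orbitPt_orbitPt (h : IrrationalLift F ρ) (m n : ℕ) (a b : ℤ) (x : ℝ) :
    orbitPt F m a (orbitPt F n b x) = orbitPt F (m + n) (a + b) x := by
  simp only [orbitPt, h.iterate_sub_int, Function.iterate_add_apply]
  push_cast; ring

theorem orbitPt_compare_self (h : IrrationalLift F ρ) (m : ℕ) (a : ℤ) (x : ℝ) :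
    ((m : ℝ) * ρ < a → orbitPt F m a x < x) ∧ ((a : ℝ) < m * ρ → x < orbitPt F m a x) := by
  let f : CircleDeg1Lift := ⟨⟨F, h.strictMono.monotone⟩, h.map_add_one⟩
  have hf : ∀ n : ℕ, ⇑(f ^ n) = F^[n] := fun n => CircleDeg1Lift.coe_pow f n
  have hτ : CircleDeg1Lift.translationNumber f = ρ := by
    refine tendsto_nhds_unique (f.tendsto_translationNumber 0) ?_
    simpa only [hf] using h.tendsto 0
  have hm : CircleDeg1Lift.translationNumber (f ^ m) = m * ρ := by
    rw [CircleDeg1Lift.translationNumber_pow, hτ]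
  constructor
  · intro h1
    rw [← hm] at h1
    have := CircleDeg1Lift.map_lt_of_translationNumber_lt_int _ h1 x
    rw [hf] at this
    simp only [orbitPt]; linarith
  · intro h1
    rw [← hm] at h1
    have := CircleDeg1Lift.lt_map_of_int_lt_translationNumber _ h1 x
    rw [hf] at this
    simp only [orbitPt]; linarith

/-- Lifted orbits are ordered as for the rigid rotation. -/
theorem orbitPt_lt_orbitPt (h : IrrationalLift F ρ) {m n : ℕ} {a b : ℤ}
    (hlt : (m : ℝ) * ρ - a < n * ρ - b) (x : ℝ) : orbitPt F m a x < orbitPt F n b x := by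
  rcases le_total m n with hmn | hmn
  · obtain ⟨d, rfl⟩ := Nat.exists_eq_add_of_le' hmn
    have := (h.orbitPt_compare_self d (b - a) (orbitPt F m a x)).2 (by push_cast at hlt ⊢; linarith)
    rwa [h.orbitPt_orbitPt, sub_add_cancel] at this
  · obtain ⟨d, rfl⟩ := Nat.exists_eq_add_of_le' hmn
    have := (h.orbitPt_compare_self d (a - b) (orbitPt F n b x)).1 (by push_cast at hlt ⊢; linarith)
    rwa [h.orbitPt_orbitPt, sub_add_cancel] at this

theorem eq_of_mul_sub_eq (hρ : Irrational ρ) {m n : ℕ} {a b : ℤ}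
    (heq : (m : ℝ) * ρ - a = n * ρ - b) : m = n ∧ a = b := by
  have hmn : m = n := by
    by_contra hne
    have h0 : ((m : ℤ) - n : ℤ) ≠ 0 := by omega
    refine (hρ.intCast_mul h0).ne_int (a - b) ?_
    push_cast; linarith
  subst hmn
  exact ⟨rfl, by have : (a : ℝ) = b := by linarith
                 exact_mod_cast this⟩

theorem orbitPt_le_orbitPt (h : IrrationalLift F ρ) {m n : ℕ} {a b : ℤ}
    (hle : (m : ℝ) * ρ - a ≤ n * ρ - b) (x : ℝ) : orbitPt F m a x ≤ orbitPt F n b x := by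
  rcases hle.lt_or_eq with hlt | heq
  · exact (h.orbitPt_lt_orbitPt hlt x).le
  · obtain ⟨rfl, rfl⟩ := eq_of_mul_sub_eq h.irrational heq
    exact le_rfl

end IrrationalLift

/-- Fundamental intervals whose integer translates are pairwise disjoint have total length at
most one. -/
theorem sum_abs_sub_le_one_of_disjoint (N : ℕ) (u v : ℕ → ℝ)
    (hdis : ∀ i < N, ∀ j < N, ∀ a b : ℤ, (i, a) ≠ (j, b) →
      Disjoint (uIoc (u i - a) (v i - a)) (uIoc (u j - b) (v j - b))) :
    ∑ i ∈ Finset.range N, |v i - u i| ≤ 1 := by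
  let s : Fin N × ℤ → Set ℝ := fun z =>
    uIoc (u z.1 - z.2) (v z.1 - z.2) ∩ Ioc 0 1
  have hvol : ∀ i : Fin N, volume (uIoc (u i) (v i)) = ∑' a : ℤ, volume (s (i, a)) := by
    intro i
    have hcov : uIoc (u i) (v i) = ⋃ a : ℤ, uIoc (u i) (v i) ∩ Ioc (a : ℝ) (a + 1) := by
      rw [← inter_iUnion, iUnion_Ioc_intCast, inter_univ]
    have hd : Pairwise (Function.onFun Disjoint
        fun a : ℤ => uIoc (u i) (v i) ∩ Ioc (a : ℝ) (a + 1)) := by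
      intro a b hab
      have := pairwise_disjoint_Ioc_intCast ℝ hab
      exact this.mono inter_subset_right inter_subset_right
    conv_lhs => rw [hcov]
    rw [measure_iUnion hd fun a => measurableSet_uIoc.inter measurableSet_Ioc]
    refine tsum_congr fun a => ?_
    have : s (i, a) = (fun y => y + (a : ℝ)) ⁻¹' (uIoc (u i) (v i) ∩ Ioc (a : ℝ) (a + 1)) := by
      ext y
      simp only [s, mem_inter_iff, mem_preimage, uIoc, mem_Ioc, min_sub_sub_right,
        max_sub_sub_right]
      constructor
      · rintro ⟨⟨h1, h2⟩, h3, h4⟩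
        exact ⟨⟨by linarith, by linarith⟩, by linarith, by linarith⟩
      · rintro ⟨⟨h1, h2⟩, h3, h4⟩
        exact ⟨⟨by linarith, by linarith⟩, by linarith, by linarith⟩
    rw [this, measure_preimage_add_right]
  have hs : Pairwise (Function.onFun Disjoint s) := by
    rintro ⟨i, a⟩ ⟨j, b⟩ hne
    refine (hdis i i.2 j j.2 a b ?_).mono inter_subset_left inter_subset_left
    intro h
    simp only [Prod.mk.injEq] at h
    exact hne (Prod.ext (Fin.ext h.1) h.2)
  have hle : ∑ i : Fin N, volume (uIoc (u i) (v i)) ≤ 1 := by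
    simp_rw [hvol]
    rw [← tsum_fintype (L := SummationFilter.unconditional _),
      ← ENNReal.tsum_prod (f := fun i a => volume (s (i, a))),
      ← measure_iUnion hs fun z => measurableSet_uIoc.inter measurableSet_Ioc]
    calc volume (⋃ z, s z) ≤ volume (Ioc (0 : ℝ) 1) :=
          measure_mono (iUnion_subset fun z => inter_subset_right)
      _ = 1 := by simp
  simp_rw [Real.volume_uIoc] at hle
  rw [← ENNReal.ofReal_sum_of_nonneg fun _ _ => abs_nonneg _, ENNReal.ofReal_le_one] at hle
  rwa [Finset.sum_range fun i => |v i - u i|]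

/-- A best-approximation step: the pair `(q, p)` approximates `ρ` better than any pair with
denominator smaller than `Q`. -/
def IsBestBefore (ρ : ℝ) (q : ℕ) (p : ℤ) (Q : ℕ) : Prop :=
  ∀ m c : ℤ, |m| < Q → (m, c) ≠ (0, 0) → |(q : ℝ) * ρ - p| ≤ |(m : ℝ) * ρ - c|

/-- The intervals between the orbits of `x` and `orbitPt F q p x` are disjoint on the circle
up to time `Q`. -/
theorem IrrationalLift.sum_abs_iterate_sub_le_one {F : ℝ → ℝ} {ρ : ℝ} (h : IrrationalLift F ρ)
    {q Q : ℕ} {p : ℤ} (hbest : IsBestBefore ρ q p Q) (x : ℝ) :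
    ∑ j ∈ Finset.range Q, |F^[j] (orbitPt F q p x) - F^[j] x| ≤ 1 := by
  have heq : ∀ (j : ℕ) (a : ℤ), F^[j] (orbitPt F q p x) - a = orbitPt F (j + q) (a + p) x :=
    fun j a => h.orbitPt_orbitPt j q a p x
  refine sum_abs_sub_le_one_of_disjoint Q (fun j => F^[j] x)
    (fun j => F^[j] (orbitPt F q p x)) ?_
  intro i hi j hj a b hne
  simp only [heq]
  change Disjoint (uIoc (orbitPt F i a x) _) (uIoc (orbitPt F j b x) _)
  have hb := hbest ((i : ℤ) - j) (a - b) (by rw [abs_lt]; omega) (by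
    intro h0
    simp only [Prod.mk.injEq] at h0
    exact hne (Prod.ext (by simp; omega) (by simp; omega)))
  have key : ∀ (i j : ℕ) (a b : ℤ),
      |(q : ℝ) * ρ - p| ≤ (j * ρ - b) - (i * ρ - a) →
      Disjoint (uIoc (orbitPt F i a x) (orbitPt F (i + q) (a + p) x))
        (uIoc (orbitPt F j b x) (orbitPt F (j + q) (b + p) x)) := by
    intro i j a b hij
    obtain ⟨h1, h2⟩ := abs_le.1 hij
    have hnn := (abs_nonneg _).trans hij
    rw [uIoc, uIoc, Set.disjoint_iff]
    rintro y ⟨⟨-, hy1⟩, hy2, -⟩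
    refine absurd (hy1.trans ?_) (not_le.2 hy2)
    refine max_le (le_min ?_ ?_) (le_min ?_ ?_) <;>
      refine h.orbitPt_le_orbitPt ?_ x <;> push_cast <;> linarith
  push_cast at hb
  rcases le_abs.1 hb with hb | hb
  · exact (key j i b a (by linarith)).symm
  · exact key i j a b (by linarith)

theorem isBestBefore_of_det {ρ : ℝ} {q Q : ℕ} {p P : ℤ} (hq : 0 < q)
    (hdet : IsUnit (p * Q - P * q))
    (hsign : ((q : ℝ) * ρ - p) * (Q * ρ - P) < 0) : IsBestBefore ρ q p Q := by
  intro m c hm hne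
  obtain ⟨e, he⟩ := hdet
  have hee : (e : ℤ) * e = 1 := by
    rcases Int.units_eq_one_or e with rfl | rfl <;> simp
  obtain ⟨u, v, hu, hv⟩ : ∃ u v : ℤ, m = u * q + v * Q ∧ c = u * p + v * P := by
    refine ⟨e * (c * Q - m * P), e * (p * m - q * c), ?_, ?_⟩
    · linear_combination (-m) * hee + e * m * he
    · linear_combination (-c) * hee + e * c * he
  set θ := (q : ℝ) * ρ - p with hθ
  set Θ := (Q : ℝ) * ρ - P with hΘ
  have hval : (m : ℝ) * ρ - c = u * θ + v * Θ := by
    rw [hu, hv, hθ, hΘ]; push_cast; ring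
  have hu0 : u ≠ 0 := by
    rintro rfl
    have hv0 : v ≠ 0 := by rintro rfl; simp [hu, hv] at hne
    have : (1 : ℤ) ≤ |v| := Int.one_le_abs hv0
    rw [hu, zero_mul, zero_add, abs_mul, Nat.abs_cast] at hm
    nlinarith [Int.natCast_nonneg Q]
  have huv : u * v ≤ 0 := by
    by_contra! hpos
    have hq' : (0 : ℤ) < q := by exact_mod_cast hq
    have hQ' : (0 : ℤ) ≤ Q := by positivity
    rw [hu, abs_lt] at hm
    rcases lt_or_gt_of_ne hu0 with hu1 | hu1
    · have hv1 : v ≤ -1 := by by_contra! hc; nlinarith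
      nlinarith
    · have hv1 : 1 ≤ v := by by_contra! hc; nlinarith
      nlinarith
  have hcross : 0 ≤ ((u : ℝ) * v) * (θ * Θ) :=
    mul_nonneg_of_nonpos_of_nonpos (by exact_mod_cast huv) hsign.le
  have hu1 : (1 : ℝ) ≤ |(u : ℝ)| := by exact_mod_cast Int.one_le_abs hu0
  have hsq : ((u : ℝ) * θ) ^ 2 ≤ ((u : ℝ) * θ + v * Θ) ^ 2 := by nlinarith [sq_nonneg ((v : ℝ) * Θ)]
  rw [hval]
  calc |θ| ≤ |(u : ℝ)| * |θ| := le_mul_of_one_le_left (abs_nonneg _) hu1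
    _ = |(u : ℝ) * θ| := (abs_mul _ _).symm
    _ ≤ _ := sq_le_sq.1 hsq

/-- The arithmetic properties of the continued fraction convergents `p n / q n` of `ρ`. -/
structure IsConvergents (ρ : ℝ) (p : ℕ → ℤ) (q : ℕ → ℕ) : Prop where
  pos : ∀ n, 0 < q n
  sign : ∀ n, 0 < (-1 : ℝ) ^ n * (q n * ρ - p n)
  det : ∀ n, p (n + 1) * q n - p n * q (n + 1) = (-1) ^ n
  recurrence : ∀ n, ∃ k : ℕ, 1 ≤ k ∧ q (n + 2) = k * q (n + 1) + q n ∧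
    p (n + 2) = k * p (n + 1) + p n

namespace IsConvergents

variable {ρ : ℝ} {p : ℕ → ℤ} {q : ℕ → ℕ}

theorem abs_eq (hc : IsConvergents ρ p q) (n : ℕ) :
    |(q n : ℝ) * ρ - p n| = (-1 : ℝ) ^ n * (q n * ρ - p n) := by
  rw [← abs_of_pos (hc.sign n), abs_mul, abs_pow, abs_neg, abs_one, one_pow, one_mul]

theorem mul_neg (hc : IsConvergents ρ p q) (n : ℕ) :
    ((q n : ℝ) * ρ - p n) * (q (n + 1) * ρ - p (n + 1)) < 0 := by
  have h := mul_pos (hc.sign n) (hc.sign (n + 1))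
  have h1 : (-1 : ℝ) ^ n * (-1 : ℝ) ^ n = 1 := by
    rw [← mul_pow]; norm_num
  have h2 : (-1 : ℝ) ^ n * (q n * ρ - p n) * ((-1 : ℝ) ^ (n + 1) * (q (n + 1) * ρ - p (n + 1)))
      = -(((-1 : ℝ) ^ n * (-1 : ℝ) ^ n) *
        (((q n : ℝ) * ρ - p n) * (q (n + 1) * ρ - p (n + 1)))) := by
    rw [pow_succ]; ring
  rw [h2, h1] at h
  linarith

theorem abs_lt_abs (hc : IsConvergents ρ p q) (n : ℕ) :
    |(q (n + 1) : ℝ) * ρ - p (n + 1)| < |(q n : ℝ) * ρ - p n| := by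
  obtain ⟨k, hk, hq, hp⟩ := hc.recurrence n
  have h0 := hc.sign n
  have h1 := hc.sign (n + 1)
  have h2 := hc.sign (n + 2)
  rw [hc.abs_eq, hc.abs_eq]
  rw [hq, hp] at h2
  push_cast at h2
  have hk' : (1 : ℝ) ≤ k := by exact_mod_cast hk
  have e : (-1 : ℝ) ^ (n + 2) * ((k * q (n + 1) + q n) * ρ - (k * p (n + 1) + p n))
    = (-1 : ℝ) ^ n * (q n * ρ - p n)
      - k * ((-1 : ℝ) ^ (n + 1) * (q (n + 1) * ρ - p (n + 1))) := by ring
  rw [e] at h2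
  nlinarith

theorem isBestBefore (hc : IsConvergents ρ p q) (n : ℕ) :
    IsBestBefore ρ (q n) (p n) (q (n + 1)) := by
  refine isBestBefore_of_det (hc.pos n) ?_ (hc.mul_neg n)
  have : p n * q (n + 1) - p (n + 1) * q n = -(-1) ^ n := by linarith [hc.det n]
  rw [this]
  exact ((isUnit_one.neg).pow n).neg

theorem add_le (hc : IsConvergents ρ p q) (n : ℕ) : q n + q (n + 1) ≤ q (n + 2) := by
  obtain ⟨k, hk, hq, -⟩ := hc.recurrence n
  nlinarith

theorem le_succ_of_pos (hc : IsConvergents ρ p q) (n : ℕ) : q (n + 1) ≤ q (n + 2) := by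
  have := hc.add_le n
  omega

theorem lt_add_two (hc : IsConvergents ρ p q) (n : ℕ) : n < q (n + 1) + 1 := by
  induction n with
  | zero => omega
  | succ n ih =>
    have := hc.add_le n
    have := hc.pos n
    have e : n + 1 + 1 = n + 2 := rfl
    rw [e]
    omega

end IsConvergents

/-- Convergents defined by the usual recursion satisfy `IsConvergents`. -/
theorem isConvergents_of_recursion {ρ : ℝ} (hirr : Irrational ρ)
    {k p q : ℕ → ℕ} (hk : ∀ n, 1 ≤ k (n + 1))
    (hp0 : p 0 = 0) (hp1 : p 1 = 1) (hq0 : q 0 = 1) (hq1 : q 1 = k 1)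
    (hprec : ∀ n, p (n + 2) = k (n + 2) * p (n + 1) + p n)
    (hqrec : ∀ n, q (n + 2) = k (n + 2) * q (n + 1) + q n)
    (hconv : Tendsto (fun n => (p n : ℝ) / (q n : ℝ)) atTop (𝓝 ρ)) :
    IsConvergents ρ (fun n => (p n : ℤ)) q := by
  have hpos : ∀ n, 0 < q n ∧ 0 < q (n + 1) := by
    intro n
    induction n with
    | zero => exact ⟨by omega, by have := hk 0; rw [zero_add] at *; omega⟩
    | succ n ih => exact ⟨ih.2, by rw [hqrec]; omega⟩
  have hdet : ∀ n, (p (n + 1) : ℤ) * q n - p n * q (n + 1) = (-1) ^ n := by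
    intro n
    induction n with
    | zero => simp [hp0, hp1, hq0]
    | succ n ih =>
      rw [show n + 1 + 1 = n + 2 from rfl, hprec, hqrec, pow_succ, ← ih]
      push_cast; ring
  refine ⟨fun n => (hpos n).1, fun n => ?_, hdet, fun n => ⟨k (n + 2), hk (n + 1), hqrec n, ?_⟩⟩
  · have hD : ∀ m, 0 ≤ (-1 : ℤ) ^ n * (p (n + m) * q n - p n * q (n + m)) ∧
        0 ≤ (-1 : ℤ) ^ n * (p (n + m + 1) * q n - p n * q (n + m + 1)) := by
      intro m
      induction m with
      | zero =>
        constructor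
        · simp [mul_comm]
        · rw [add_zero, hdet n, ← mul_pow]; norm_num
      | succ m ih =>
        refine ⟨ih.2, ?_⟩
        rw [show n + (m + 1) + 1 = n + m + 2 by ring, hprec, hqrec]
        have e : (-1 : ℤ) ^ n * (((k (n + m + 2) * p (n + m + 1) + p (n + m) : ℕ) : ℤ) * q n
            - p n * ((k (n + m + 2) * q (n + m + 1) + q (n + m) : ℕ) : ℤ))
          = k (n + m + 2) * ((-1 : ℤ) ^ n * (p (n + m + 1) * q n - p n * q (n + m + 1)))
            + (-1 : ℤ) ^ n * (p (n + m) * q n - p n * q (n + m)) := by push_cast; ring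
        rw [e]
        exact add_nonneg (mul_nonneg (by positivity) ih.2) ih.1
    have hlim : Tendsto (fun m => (-1 : ℝ) ^ n * ((p m : ℝ) / q m * q n - p n)) atTop
        (𝓝 ((-1 : ℝ) ^ n * (ρ * q n - p n))) :=
      ((hconv.mul_const _).sub_const _).const_mul _
    have hge : 0 ≤ (-1 : ℝ) ^ n * (ρ * q n - p n) := by
      refine ge_of_tendsto hlim ?_
      filter_upwards [eventually_ge_atTop n] with m hm
      obtain ⟨d, rfl⟩ := Nat.exists_eq_add_of_le hm
      have h1 : (0 : ℝ) ≤ (-1 : ℝ) ^ n * (p (n + d) * q n - p n * q (n + d)) := by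
        exact_mod_cast (hD d).1
      have h2 : (0 : ℝ) < q (n + d) := by exact_mod_cast (hpos (n + d)).1
      have e : (-1 : ℝ) ^ n * ((p (n + d) : ℝ) / q (n + d) * q n - p n)
        = ((-1 : ℝ) ^ n * (p (n + d) * q n - p n * q (n + d))) / q (n + d) := by
        field_simp
      rw [e]
      positivity
    rw [mul_comm (q n : ℝ)]
    push_cast
    refine hge.lt_of_ne' (mul_ne_zero (pow_ne_zero _ (by norm_num)) ?_)
    have := (hirr.mul_natCast (hpos n).1.ne').ne_nat (p n)
    exact sub_ne_zero.2 this
  · simp only [hprec]; push_cast; ring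

namespace IrrationalLift

variable {F : ℝ → ℝ} {ρ : ℝ}

/-- Every point lies in an interval of the dynamical partition generated by `y`. -/
theorem exists_mem_uIcc_orbitPt (h : IrrationalLift F ρ) {q Q : ℕ} {p P : ℤ} (hq : 0 < q)
    (hsign : ((q : ℝ) * ρ - p) * (Q * ρ - P) < 0)
    (hle : |(Q : ℝ) * ρ - P| ≤ |(q : ℝ) * ρ - p|) (y x : ℝ) :
    ∃ i < q + Q, ∃ a : ℤ, x ∈ uIcc (orbitPt F i a y) (orbitPt F (i + q) (a + p) y) := by
  obtain ⟨i, hi, hmax⟩ := Finset.exists_max_image (Finset.range (q + Q))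
    (fun j => orbitPt F j ⌈F^[j] y - x⌉ y) ⟨0, by simp; omega⟩
  rw [Finset.mem_range] at hi
  set a := ⌈F^[i] y - x⌉ with ha
  have hzx : orbitPt F i a y ≤ x := by
    have := Int.le_ceil (F^[i] y - x)
    simp only [orbitPt]; linarith
  have hnext : ∀ j < q + Q, ∀ b : ℤ, (i : ℝ) * ρ - a < j * ρ - b → x < orbitPt F j b y := by
    intro j hj b hlt
    by_contra! hcon
    have h1 : ⌈F^[j] y - x⌉ ≤ b := Int.ceil_le.2 (by simp only [orbitPt] at hcon; linarith)
    have h2 := hmax j (Finset.mem_range.2 hj)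
    have h3 : orbitPt F j b y ≤ orbitPt F j ⌈F^[j] y - x⌉ y := by
      have : ((⌈F^[j] y - x⌉ : ℤ) : ℝ) ≤ b := by exact_mod_cast h1
      simp only [orbitPt]; linarith
    exact absurd (h.orbitPt_lt_orbitPt hlt y) (not_lt.2 (h3.trans h2))
  rcases mul_neg_iff.1 hsign with ⟨hθ, hΘ⟩ | ⟨hθ, hΘ⟩
  · rw [abs_of_pos hθ, abs_of_neg hΘ] at hle
    refine ⟨i, hi, a, mem_uIcc.2 (Or.inl ⟨hzx, ?_⟩)⟩
    rcases lt_or_ge i Q with hiQ | hiQ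
    · exact (hnext (i + q) (by omega) (a + p) (by push_cast; linarith)).le
    · obtain ⟨d, rfl⟩ := Nat.exists_eq_add_of_le' hiQ
      refine (hnext d (by omega) (a - P) (by push_cast; linarith)).le.trans
        (h.orbitPt_le_orbitPt ?_ y)
      push_cast; linarith
  · rw [abs_of_neg hθ, abs_of_pos hΘ] at hle
    rcases lt_or_ge i q with hiq | hiq
    · refine ⟨i + Q, by omega, a + P, mem_uIcc.2 (Or.inr ⟨?_, ?_⟩)⟩
      · refine le_trans (h.orbitPt_le_orbitPt ?_ y) hzx
        push_cast; linarith
      · exact (hnext (i + Q) (by omega) (a + P) (by push_cast; linarith)).le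
    · obtain ⟨d, rfl⟩ := Nat.exists_eq_add_of_le' hiq
      refine ⟨d, by omega, a - p, mem_uIcc.2 (Or.inr ⟨?_, ?_⟩)⟩
      · rwa [sub_add_cancel]
      · exact (hnext d (by omega) (a - p) (by push_cast; linarith)).le

theorem sum_abs_iterate_sub_le_of_mem (h : IrrationalLift F ρ) (N : ℕ) {a b u v : ℝ}
    (hu : u ∈ uIcc a b) (hv : v ∈ uIcc a b) :
    ∑ j ∈ Finset.range N, |F^[j] v - F^[j] u| ≤ ∑ j ∈ Finset.range N, |F^[j] b - F^[j] a| := by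
  refine Finset.sum_le_sum fun j _ => ?_
  have hm := (h.strictMono_iterate j).monotone
  exact abs_sub_le_of_uIcc_subset_uIcc
    (uIcc_subset_uIcc (hm.image_uIcc_subset (mem_image_of_mem _ hu))
      (hm.image_uIcc_subset (mem_image_of_mem _ hv)))

theorem abs_birkhoffSum_sub_le {L : ℝ → ℝ} {G : ℝ}
    (hL : ∀ u v, |L u - L v| ≤ G * |u - v|) (N : ℕ) (u v : ℝ) :
    |birkhoffSum F L N v - birkhoffSum F L N u| ≤
      G * ∑ j ∈ Finset.range N, |F^[j] v - F^[j] u| := by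
  rw [birkhoffSum, birkhoffSum, ← Finset.sum_sub_distrib, Finset.mul_sum]
  exact (Finset.abs_sum_le_sum_abs _ _).trans (Finset.sum_le_sum fun j _ => hL _ _)

theorem birkhoffSum_sub_int (h : IrrationalLift F ρ) {L : ℝ → ℝ}
    (hper : ∀ (x : ℝ) (a : ℤ), L (x - a) = L x) (N : ℕ) (x : ℝ) (a : ℤ) :
    birkhoffSum F L N (x - a) = birkhoffSum F L N x := by
  simp only [birkhoffSum, h.iterate_sub_int, hper]

/-- The Denjoy inequality. -/
theorem abs_birkhoffSum_le (h : IrrationalLift F ρ) {p : ℕ → ℤ} {q : ℕ → ℕ}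
    (hc : IsConvergents ρ p q) {L : ℝ → ℝ} {G : ℝ} (hG : 0 ≤ G)
    (hL : ∀ u v, |L u - L v| ≤ G * |u - v|)
    (hper : ∀ (x : ℝ) (a : ℤ), L (x - a) = L x) (n : ℕ)
    {y : ℝ} (hy : birkhoffSum F L (q (n + 1)) y = 0) (x : ℝ) :
    |birkhoffSum F L (q (n + 1)) x| ≤ 2 * G := by
  obtain ⟨i, hi, a, hx⟩ := h.exists_mem_uIcc_orbitPt (hc.pos n) (hc.mul_neg n)
    (hc.abs_lt_abs n).le y x
  set z := orbitPt F i a y with hz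
  have h1 : |birkhoffSum F L (q (n + 1)) x - birkhoffSum F L (q (n + 1)) z| ≤ G * 1 := by
    refine (abs_birkhoffSum_sub_le hL _ _ _).trans (mul_le_mul_of_nonneg_left ?_ hG)
    refine (h.sum_abs_iterate_sub_le_of_mem _ left_mem_uIcc ?_).trans
      (h.sum_abs_iterate_sub_le_one (hc.isBestBefore n) z)
    rwa [hz, h.orbitPt_orbitPt, add_comm (q n), add_comm (p n)]
  have h2 : birkhoffSum F L (q (n + 1)) z =
      birkhoffSum F L i (orbitPt F (q (n + 1)) (p (n + 1)) y) - birkhoffSum F L i y := by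
    rw [hz, orbitPt, orbitPt, h.birkhoffSum_sub_int hper, h.birkhoffSum_sub_int hper]
    have e1 := birkhoffSum_add F L (q (n + 1)) i y
    rw [add_comm, birkhoffSum_add, hy] at e1
    linarith
  have h3 : |birkhoffSum F L i (orbitPt F (q (n + 1)) (p (n + 1)) y) - birkhoffSum F L i y|
      ≤ G * 1 := by
    refine (abs_birkhoffSum_sub_le hL _ _ _).trans (mul_le_mul_of_nonneg_left ?_ hG)
    refine le_trans ?_ (h.sum_abs_iterate_sub_le_one (hc.isBestBefore (n + 1)) y)
    refine Finset.sum_le_sum_of_subset_of_nonneg ?_ fun _ _ _ => abs_nonneg _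
    exact Finset.range_subset_range.2 (hi.le.trans (hc.add_le n))
  rw [h2] at h1
  have := abs_le.1 h1
  have := abs_le.1 h3
  rw [abs_le]
  constructor <;> linarith

end IrrationalLift

theorem IsModulus.mono {w : ℝ → ℝ} (hw : IsModulus w) {a b : ℝ} (ha : 0 < a) (hab : a ≤ b) :
    w a ≤ w b :=
  hw.strictMono.monotoneOn ha (ha.trans_le hab) hab

/-- A modulus of continuity is at least linear near zero. -/
theorem IsModulus.linear_le {w : ℝ → ℝ} (hw : IsModulus w) {h : ℝ} (h0 : 0 < h) (h1 : h ≤ 1) :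
    h ≤ 2 / w 1 * w h := by
  have hn : ∀ n : ℕ, w ((n + 1 : ℕ) * h) ≤ (n + 1 : ℕ) * w h := by
    intro n
    induction n with
    | zero => simp
    | succ n ih =>
      have h2 : (((n + 1 + 1 : ℕ) : ℝ)) * h = ((n + 1 : ℕ) : ℝ) * h + h := by push_cast; ring
      rw [h2]
      refine (hw.subadd _ _ (by positivity) h0).trans ?_
      push_cast at ih ⊢
      linarith
  have hw1 := hw.pos 1 one_pos
  have hwh := hw.pos h h0
  have hfl : 1 / h ≤ (⌊1 / h⌋₊ + 1 : ℕ) := by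
    push_cast; exact (Nat.lt_floor_add_one _).le
  have hfl2 : ((⌊1 / h⌋₊ + 1 : ℕ) : ℝ) ≤ 2 / h := by
    push_cast
    have := Nat.floor_le (show 0 ≤ 1 / h by positivity)
    have h3 : 1 ≤ 1 / h := by rw [le_div_iff₀ h0]; linarith
    have h4 : 2 / h = 1 / h + 1 / h := by ring
    linarith
  have h5 : w 1 ≤ 2 / h * w h := by
    refine (hw.mono one_pos ?_).trans ((hn ⌊1 / h⌋₊).trans
      (mul_le_mul_of_nonneg_right hfl2 hwh.le))
    rwa [div_le_iff₀ h0] at hfl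
  rw [div_mul_eq_mul_div, le_div_iff₀ hw1]
  rw [div_mul_eq_mul_div, le_div_iff₀ h0] at h5
  linarith

theorem abs_log_sub_log_le {m a b : ℝ} (hm : 0 < m) (ha : m ≤ a) (hb : m ≤ b) :
    |Real.log a - Real.log b| ≤ |a - b| / m := by
  have key : ∀ {a b : ℝ}, m ≤ a → m ≤ b → Real.log a - Real.log b ≤ |a - b| / m := by
    intro a b ha hb
    have ha0 := hm.trans_le ha
    have hb0 := hm.trans_le hb
    rw [← Real.log_div ha0.ne' hb0.ne']
    calc Real.log (a / b) ≤ a / b - 1 := Real.log_le_sub_one_of_pos (by positivity)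
      _ = (a - b) / b := by field_simp
      _ ≤ |a - b| / b := by gcongr; exact le_abs_self _
      _ ≤ |a - b| / m := by gcongr
  rw [abs_le]
  have h1 := key ha hb
  have h2 := key hb ha
  rw [abs_sub_comm] at h2
  constructor <;> linarith

/-- The gap between the logarithm of the arithmetic mean and of the geometric mean is
quadratic. -/
theorem abs_log_mean_sub_le {m a b : ℝ} (hm : 0 < m) (ha : m ≤ a) (hb : m ≤ b) :
    |Real.log ((a + b) / 2) - (Real.log a + Real.log b) / 2| ≤ (a - b) ^ 2 / (4 * m ^ 2) := by
  have ha0 := hm.trans_le ha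
  have hb0 := hm.trans_le hb
  have hs : 0 < (a + b) / 2 := by positivity
  have e1 := Real.log_le_sub_one_of_pos (show 0 < (a + b) / 2 / a by positivity)
  have e2 := Real.log_le_sub_one_of_pos (show 0 < (a + b) / 2 / b by positivity)
  have e3 := Real.log_le_sub_one_of_pos (show 0 < a / ((a + b) / 2) by positivity)
  have e4 := Real.log_le_sub_one_of_pos (show 0 < b / ((a + b) / 2) by positivity)
  rw [Real.log_div (by positivity) (by positivity)] at e1 e2 e3 e4
  have f1 : (a + b) / 2 / a - 1 + ((a + b) / 2 / b - 1) = (a - b) ^ 2 / (2 * (a * b)) := by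
    field_simp; ring
  have f2 : a / ((a + b) / 2) - 1 + (b / ((a + b) / 2) - 1) = 0 := by
    field_simp; ring
  have f3 : (a - b) ^ 2 / (2 * (a * b)) ≤ (a - b) ^ 2 / (2 * m ^ 2) := by
    gcongr; nlinarith
  have f4 : (a - b) ^ 2 / (4 * m ^ 2) = (a - b) ^ 2 / (2 * m ^ 2) / 2 := by
    field_simp; ring
  rw [abs_le, f4]
  have f5 : 0 ≤ (a - b) ^ 2 / (2 * m ^ 2) := by positivity
  constructor <;> linarith

/-- Trapezoidal estimate for a `C²` function whose second derivative has modulus `w`. -/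
theorem abs_trapezoid_le {w F F' F'' : ℝ → ℝ} (hw : IsModulus w)
    (hF' : ∀ x, HasDerivAt F (F' x) x) (hF'' : ∀ x, HasDerivAt F' (F'' x) x)
    (hmod : ∀ x y : ℝ, x ≠ y → |F'' x - F'' y| ≤ w |x - y|) {u v : ℝ} (huv : u ≠ v) :
    |F v - F u - (v - u) * ((F' u + F' v) / 2)| ≤ |v - u| * w |v - u| / 2 * |v - u| := by
  have hpos : 0 < |v - u| := abs_pos.2 (sub_ne_zero.2 huv.symm)
  have hw0 := hw.pos _ hpos
  have htaylor : ∀ t ∈ uIcc u v, |F' t - F' u - (t - u) * F'' t| ≤ |v - u| * w |v - u| := by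
    intro t ht
    have htu : |t - u| ≤ |v - u| := abs_sub_left_of_mem_uIcc ht
    have hd : ∀ s ∈ uIcc u t, HasDerivWithinAt (fun s => F' s - s * F'' t) (F'' s - 1 * F'' t)
        (uIcc u t) s := fun s _ =>
      ((hF'' s).sub ((hasDerivAt_id s).mul_const _)).hasDerivWithinAt
    have hb : ∀ s ∈ uIcc u t, ‖F'' s - 1 * F'' t‖ ≤ w |v - u| := by
      intro s hs
      rw [one_mul, Real.norm_eq_abs]
      rcases eq_or_ne s t with rfl | hst
      · simpa using hw0.le
      · refine (hmod s t hst).trans (hw.mono (abs_pos.2 (sub_ne_zero.2 hst)) ?_)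
        rw [abs_sub_comm]
        exact (abs_sub_right_of_mem_uIcc hs).trans htu
    have := (convex_uIcc u t).norm_image_sub_le_of_norm_hasDerivWithin_le hd hb
      left_mem_uIcc right_mem_uIcc
    simp only [Real.norm_eq_abs] at this
    have e : F' t - t * F'' t - (F' u - u * F'' t) = F' t - F' u - (t - u) * F'' t := by ring
    rw [e] at this
    nlinarith [abs_nonneg (t - u)]
  have hd : ∀ t ∈ uIcc u v, HasDerivWithinAt
      (fun t => F t - F u - (t - u) * ((F' u + F' t) / 2))
      (F' t - (1 * ((F' u + F' t) / 2) + (t - u) * (F'' t / 2))) (uIcc u v) t := fun t _ =>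
    (((hF' t).sub_const _).sub (((hasDerivAt_id t).sub_const u).mul
      (((hF'' t).const_add _).div_const 2))).hasDerivWithinAt
  have hb : ∀ t ∈ uIcc u v, ‖F' t - (1 * ((F' u + F' t) / 2) + (t - u) * (F'' t / 2))‖ ≤
      |v - u| * w |v - u| / 2 := by
    intro t ht
    have e : F' t - (1 * ((F' u + F' t) / 2) + (t - u) * (F'' t / 2))
      = (F' t - F' u - (t - u) * F'' t) / 2 := by ring
    rw [e, Real.norm_eq_abs, abs_div, abs_two]
    linarith [htaylor t ht]
  have := (convex_uIcc u v).norm_image_sub_le_of_norm_hasDerivWithin_le hd hb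
    left_mem_uIcc right_mem_uIcc
  simpa using this

/-- Bounds satisfied by a `C²` circle diffeomorphism whose second derivative has modulus `w`,
with `L` in the role of the logarithm of the derivative. -/
structure HasDistortionBounds (F L w : ℝ → ℝ) (G C : ℝ) : Prop where
  hasDerivAt : ∀ x, HasDerivAt F (Real.exp (L x)) x
  periodic : ∀ (x : ℝ) (a : ℤ), L (x - a) = L x
  nonneg : 0 ≤ G
  lipschitz : ∀ u v, |L u - L v| ≤ G * |u - v|
  const_nonneg : 0 ≤ C
  slope : ∀ u v, u ≠ v → |v - u| ≤ 1 →
    |Real.log ((F v - F u) / (v - u)) - (L u + L v) / 2| ≤ C * |v - u| * w |v - u|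

theorem exists_hasDistortionBounds {w F F' F'' : ℝ → ℝ} (hw : IsModulus w)
    (hFp : ∀ x, F (x + 1) = F x + 1)
    (hF' : ∀ x, HasDerivAt F (F' x) x) (hF'' : ∀ x, HasDerivAt F' (F'' x) x)
    (hF'pos : ∀ x, 0 < F' x)
    (hmod : ∀ x y : ℝ, x ≠ y → |F'' x - F'' y| ≤ w |x - y|) :
    ∃ G C, HasDistortionBounds F (fun x => Real.log (F' x)) w G C := by
  have hper' : Function.Periodic F' 1 := by
    intro x
    have h1 : HasDerivAt (fun y => F (y + 1)) (F' (x + 1)) x := (hF' (x + 1)).comp_add_const x 1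
    have h2 : HasDerivAt (fun y => F (y + 1)) (F' x) x := by
      simp only [hFp]; exact (hF' x).add_const 1
    exact h1.unique h2
  have hper'' : Function.Periodic F'' 1 := by
    intro x
    have h1 : HasDerivAt (fun y => F' (y + 1)) (F'' (x + 1)) x :=
      (hF'' (x + 1)).comp_add_const x 1
    have h2 : HasDerivAt (fun y => F' (y + 1)) (F'' x) x := by
      simp only [hper' _]; exact hF'' x
    exact h1.unique h2
  have hcont : Continuous F' := continuous_iff_continuousAt.2 fun x => (hF'' x).continuousAt
  obtain ⟨x0, -, hx0⟩ := isCompact_Icc.exists_isMinOn (nonempty_Icc.2 zero_le_one)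
    (hcont.continuousOn (s := Icc (0 : ℝ) 1))
  have hm : ∀ x, F' x0 ≤ F' x := by
    intro x
    obtain ⟨y, hy, hxy⟩ := hper'.exists_mem_Ico₀ one_pos x
    rw [hxy]
    exact hx0 (Ico_subset_Icc_self hy)
  set m := F' x0
  have hm0 : 0 < m := hF'pos x0
  have hw1 := hw.pos 1 one_pos
  set B := |F'' 0| + w 1
  have hB0 : 0 ≤ B := by positivity
  have hB : ∀ x, |F'' x| ≤ B := by
    intro x
    obtain ⟨y, hy, hxy⟩ := hper''.exists_mem_Ico₀ one_pos x
    rw [hxy]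
    have h1 : |F'' y - F'' 0| ≤ w 1 := by
      rcases eq_or_ne y 0 with rfl | h0
      · simpa using hw1.le
      · refine (hmod y 0 h0).trans (hw.mono (abs_pos.2 (by simpa using h0)) ?_)
        rw [sub_zero, abs_of_nonneg hy.1]; exact hy.2.le
    calc |F'' y| = |F'' 0 + (F'' y - F'' 0)| := by ring_nf
      _ ≤ _ := (abs_add_le _ _).trans (by linarith)
  have hlip : ∀ u v, |F' u - F' v| ≤ B * |u - v| := by
    intro u v
    have := convex_univ.norm_image_sub_le_of_norm_hasDerivWithin_le
      (fun x _ => (hF'' x).hasDerivWithinAt) (fun x _ => hB x) (mem_univ v) (mem_univ u)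
    simpa using this
  refine ⟨B / m, 1 / (2 * m) + B ^ 2 / (4 * m ^ 2) * (2 / w 1), ?_, ?_, by positivity, ?_,
    by positivity, ?_⟩
  · intro x
    rw [Real.exp_log (hF'pos x)]; exact hF' x
  · intro x a
    have := hper'.sub_int_mul_eq (x := x) a
    rw [mul_one] at this
    simp only [this]
  · intro u v
    refine (abs_log_sub_log_le hm0 (hm u) (hm v)).trans ?_
    rw [div_mul_eq_mul_div]
    gcongr
    exact hlip u v
  · intro u v huv hle
    have hpos : 0 < |v - u| := abs_pos.2 (sub_ne_zero.2 huv.symm)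
    have hvu : v - u ≠ 0 := sub_ne_zero.2 huv.symm
    have hwp := hw.pos _ hpos
    have htrap := abs_trapezoid_le hw hF' hF'' hmod huv
    have hslope : m ≤ (F v - F u) / (v - u) := by
      rcases lt_or_gt_of_ne huv with hlt | hlt
      · obtain ⟨c, -, hc⟩ := exists_hasDerivAt_eq_slope F F' hlt
          (fun x _ => (hF' x).continuousAt.continuousWithinAt) fun x _ => hF' x
        rw [← hc]; exact hm c
      · obtain ⟨c, -, hc⟩ := exists_hasDerivAt_eq_slope F F' hlt
          (fun x _ => (hF' x).continuousAt.continuousWithinAt) fun x _ => hF' x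
        rw [← neg_div_neg_eq, neg_sub, neg_sub, ← hc]; exact hm c
    have h1 : |(F v - F u) / (v - u) - (F' u + F' v) / 2| ≤ |v - u| * w |v - u| / 2 := by
      have e : (F v - F u) / (v - u) - (F' u + F' v) / 2
        = (F v - F u - (v - u) * ((F' u + F' v) / 2)) / (v - u) := by field_simp
      rw [e, abs_div, div_le_iff₀ hpos]
      exact htrap
    have h2 := abs_log_sub_log_le hm0 hslope
      (show m ≤ (F' u + F' v) / 2 by linarith [hm u, hm v])
    have h3 := abs_log_mean_sub_le hm0 (hm u) (hm v)
    have h4 : (F' u - F' v) ^ 2 ≤ B ^ 2 * (|v - u| * (2 / w 1 * w |v - u|)) := by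
      have h5 : (F' u - F' v) ^ 2 ≤ (B * |v - u|) ^ 2 := by
        rw [← sq_abs (F' u - F' v), abs_sub_comm v u]
        exact pow_le_pow_left₀ (abs_nonneg _) (hlip u v) 2
      refine h5.trans ?_
      rw [mul_pow, sq |v - u|]
      have := hw.linear_le hpos hle
      gcongr
    calc _ = |(Real.log ((F v - F u) / (v - u)) - Real.log ((F' u + F' v) / 2)) +
          (Real.log ((F' u + F' v) / 2) - (Real.log (F' u) + Real.log (F' v)) / 2)| := by
          ring_nf
      _ ≤ |v - u| * w |v - u| / 2 / m +
          B ^ 2 * (|v - u| * (2 / w 1 * w |v - u|)) / (4 * m ^ 2) := by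
          refine (abs_add_le _ _).trans (add_le_add (h2.trans ?_) (h3.trans ?_)) <;> gcongr
      _ = _ := by field_simp

namespace HasDistortionBounds

variable {F L w : ℝ → ℝ} {G C : ℝ}

theorem hasDerivAt_iterate (hd : HasDistortionBounds F L w G C) (n : ℕ) (x : ℝ) :
    HasDerivAt F^[n] (Real.exp (birkhoffSum F L n x)) x := by
  induction n with
  | zero => simpa using hasDerivAt_id x
  | succ n ih =>
    rw [birkhoffSum_succ, Real.exp_add, mul_comm, Function.iterate_succ']
    exact (hd.hasDerivAt _).comp x ih

theorem exists_iterate_sub (hd : HasDistortionBounds F L w G C) (n : ℕ) (u v : ℝ) :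
    ∃ c, F^[n] v - F^[n] u = Real.exp (birkhoffSum F L n c) * (v - u) := by
  have key : ∀ u v, u < v →
      ∃ c, F^[n] v - F^[n] u = Real.exp (birkhoffSum F L n c) * (v - u) := by
    intro u v huv
    obtain ⟨c, -, hc⟩ := exists_hasDerivAt_eq_slope F^[n] _ huv
      (fun x _ => (hd.hasDerivAt_iterate n x).continuousAt.continuousWithinAt)
      fun x _ => hd.hasDerivAt_iterate n x
    exact ⟨c, by rw [hc, div_mul_cancel₀ _ (sub_pos.2 huv).ne']⟩
  rcases lt_trichotomy u v with huv | rfl | huv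
  · exact key u v huv
  · exact ⟨u, by simp⟩
  · obtain ⟨c, hc⟩ := key v u huv
    exact ⟨c, by linarith⟩

theorem continuous_birkhoffSum (hd : HasDistortionBounds F L w G C) (n : ℕ) :
    Continuous (birkhoffSum F L n) := by
  have hF : Continuous F := continuous_iff_continuousAt.2 fun x => (hd.hasDerivAt x).continuousAt
  have hL : Continuous L := by
    refine (LipschitzWith.of_dist_le_mul (K := ⟨G, hd.nonneg⟩) fun u v => ?_).continuous
    exact hd.lipschitz u v
  exact continuous_finsetSum _ fun j _ => hL.comp (hF.iterate j)

/-- The divided difference of an iterate is the geometric mean of its derivatives at the end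
points, up to an error controlled by the lengths of the intermediate intervals. -/
theorem abs_log_slope_iterate_le (hd : HasDistortionBounds F L w G C) (hw : IsModulus w)
    (hmono : StrictMono F) {N : ℕ} {u v η : ℝ} (huv : u ≠ v)
    (hsum : ∑ j ∈ Finset.range N, |F^[j] v - F^[j] u| ≤ 1)
    (hη : ∀ j < N, |F^[j] v - F^[j] u| ≤ η) (hη0 : 0 < η) :
    |Real.log ((F^[N] v - F^[N] u) / (v - u)) -
      (birkhoffSum F L N u + birkhoffSum F L N v) / 2| ≤ C * w η := by
  have hne : ∀ j, F^[j] v - F^[j] u ≠ 0 := fun j =>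
    sub_ne_zero.2 fun h => huv ((hmono.iterate j).injective h).symm
  have key : ∀ n ≤ N, |Real.log ((F^[n] v - F^[n] u) / (v - u)) -
      (birkhoffSum F L n u + birkhoffSum F L n v) / 2| ≤
      ∑ j ∈ Finset.range n, C * |F^[j] v - F^[j] u| * w η := by
    intro n hn
    induction n with
    | zero => simp
    | succ n ih =>
      have h1 : |F^[n] v - F^[n] u| ≤ 1 :=
        (Finset.single_le_sum (f := fun j => |F^[j] v - F^[j] u|) (fun j _ => abs_nonneg _)
          (Finset.mem_range.2 (by omega : n < N))).trans hsum
      have h2 := hd.slope (F^[n] u) (F^[n] v) (sub_ne_zero.1 (hne n)).symm h1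
      have h3 : w |F^[n] v - F^[n] u| ≤ w η := hw.mono (abs_pos.2 (hne n)) (hη n (by omega))
      have h4 : (F^[n + 1] v - F^[n + 1] u) / (v - u) =
          (F^[n] v - F^[n] u) / (v - u) *
            ((F (F^[n] v) - F (F^[n] u)) / (F^[n] v - F^[n] u)) := by
        have := hne n
        rw [Function.iterate_succ_apply', Function.iterate_succ_apply']
        field_simp
      have hne1 := hne (n + 1)
      rw [Function.iterate_succ_apply', Function.iterate_succ_apply'] at hne1
      have hvu : v - u ≠ 0 := hne 0
      rw [Finset.sum_range_succ, h4, Real.log_mul (div_ne_zero (hne n) hvu)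
        (div_ne_zero hne1 (hne n)), birkhoffSum_succ, birkhoffSum_succ]
      refine le_trans (le_of_eq ?_) ((abs_add_le _ _).trans (add_le_add (ih (by omega))
        (h2.trans (mul_le_mul_of_nonneg_left h3 (mul_nonneg hd.const_nonneg (abs_nonneg _))))))
      congr 1; ring
  refine (key N le_rfl).trans ?_
  rw [← Finset.sum_mul, ← Finset.mul_sum]
  have := hw.pos η hη0
  have := hd.const_nonneg
  calc C * (∑ j ∈ Finset.range N, |F^[j] v - F^[j] u|) * w η ≤ C * 1 * w η := by gcongr
    _ = C * w η := by ring

end HasDistortionBounds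

theorem IrrationalLift.exists_abs_birkhoffSum_le {F L w : ℝ → ℝ} {ρ G C : ℝ}
    (h : IrrationalLift F ρ) (hd : HasDistortionBounds F L w G C) (N : ℕ) :
    ∃ B, ∀ x, |birkhoffSum F L N x| ≤ B := by
  obtain ⟨x0, -, hx0⟩ := isCompact_Icc.exists_isMaxOn (nonempty_Icc.2 zero_le_one)
    ((hd.continuous_birkhoffSum N).abs.continuousOn (s := Icc (0 : ℝ) 1))
  refine ⟨|birkhoffSum F L N x0|, fun x => ?_⟩
  rw [← h.birkhoffSum_sub_int hd.periodic N x ⌊x⌋]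
  exact hx0 (Ico_subset_Icc_self ⟨Int.fract_nonneg x, Int.fract_lt_one x⟩)

/-- Uniform bound for the logarithmic derivatives at all closest return times. -/
theorem IrrationalLift.exists_uniform_bound {F L w : ℝ → ℝ} {ρ G C : ℝ} {p : ℕ → ℤ} {q : ℕ → ℕ}
    (h : IrrationalLift F ρ) (hc : IsConvergents ρ p q) (hd : HasDistortionBounds F L w G C) :
    ∃ D, ∀ n x, |birkhoffSum F L (q n) x| ≤ D := by
  obtain ⟨B, hB⟩ := h.exists_abs_birkhoffSum_le hd (q 0)
  refine ⟨max B (2 * G), fun n x => ?_⟩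
  cases n with
  | zero => exact (hB x).trans (le_max_left _ _)
  | succ n =>
    obtain ⟨y, hy⟩ := hd.exists_iterate_sub (q (n + 1)) 0 1
    have h1 := h.iterate_sub_int (q (n + 1)) 1 1
    have hy0 : birkhoffSum F L (q (n + 1)) y = 0 := by
      rw [← Real.exp_eq_one_iff]
      push_cast at h1
      rw [sub_self] at h1
      linarith
    exact (h.abs_birkhoffSum_le hc hd.nonneg hd.lipschitz hd.periodic n hy0 x).trans
      (le_max_right _ _)

theorem IrrationalLift.mul_orbitPt_le {F : ℝ → ℝ} {ρ : ℝ} (h : IrrationalLift F ρ) {m n : ℕ}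
    {a b : ℤ} {s : ℝ} (hs : s = 1 ∨ s = -1)
    (hle : s * ((m : ℝ) * ρ - a) ≤ s * (n * ρ - b)) (x : ℝ) :
    s * orbitPt F m a x ≤ s * orbitPt F n b x := by
  rcases hs with rfl | rfl
  · rw [one_mul, one_mul] at hle ⊢
    exact h.orbitPt_le_orbitPt hle x
  · have := h.orbitPt_le_orbitPt (show (n : ℝ) * ρ - b ≤ m * ρ - a by linarith) x
    linarith

theorem orbitPt_zero (F : ℝ → ℝ) (x : ℝ) : orbitPt F 0 0 x = x := by
  simp [orbitPt]

section Returns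

variable {F L w : ℝ → ℝ} {ρ G C D : ℝ} {p : ℕ → ℤ} {q : ℕ → ℕ}

theorem exists_orbitPt_sub (hd : HasDistortionBounds F L w G C)
    (hD : ∀ n x, |birkhoffSum F L (q n) x| ≤ D) (n : ℕ) (u v : ℝ) :
    ∃ E, Real.exp (-D) ≤ E ∧ E ≤ Real.exp D ∧
      orbitPt F (q n) (p n) v - orbitPt F (q n) (p n) u = E * (v - u) := by
  obtain ⟨c, hc⟩ := hd.exists_iterate_sub (q n) u v
  obtain ⟨h1, h2⟩ := abs_le.1 (hD n c)
  exact ⟨_, Real.exp_le_exp.2 h1, Real.exp_le_exp.2 h2, by rw [← hc]; simp only [orbitPt]; ring⟩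

theorem orbitPt_sub_mul_pos (h : IrrationalLift F ρ) (hc : IsConvergents ρ p q)
    (n : ℕ) (x : ℝ) :
    0 < (-1 : ℝ) ^ n * (orbitPt F (q n) (p n) x - x) := by
  have hs := hc.sign n
  rcases neg_one_pow_eq_or ℝ n with he | he <;> rw [he] at hs ⊢
  · have := (h.orbitPt_compare_self (q n) (p n) x).2 (by linarith)
    linarith
  · have := (h.orbitPt_compare_self (q n) (p n) x).1 (by linarith)
    linarith

theorem abs_orbitPt_sub_eq (h : IrrationalLift F ρ) (hc : IsConvergents ρ p q)
    (n : ℕ) (x : ℝ) :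
    |orbitPt F (q n) (p n) x - x| = (-1 : ℝ) ^ n * (orbitPt F (q n) (p n) x - x) := by
  rw [← abs_of_pos (orbitPt_sub_mul_pos h hc n x), abs_mul, abs_pow, abs_neg, abs_one, one_pow,
    one_mul]

theorem orbitPt_sub_ne_zero (h : IrrationalLift F ρ) (hc : IsConvergents ρ p q)
    (n : ℕ) (x : ℝ) : orbitPt F (q n) (p n) x - x ≠ 0 := by
  intro h0
  have := orbitPt_sub_mul_pos h hc n x
  simp [h0] at this

/-- Return intervals two generations apart are nested and shrink by a definite factor. -/
theorem abs_orbitPt_sub_add_two_le (h : IrrationalLift F ρ) (hc : IsConvergents ρ p q)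
    (hd : HasDistortionBounds F L w G C)
    (hD : ∀ n x, |birkhoffSum F L (q n) x| ≤ D) (n : ℕ) (x : ℝ) :
    |orbitPt F (q (n + 2)) (p (n + 2)) x - x| ≤
      1 / (1 + Real.exp (-D) ^ 2) * |orbitPt F (q n) (p n) x - x| := by
  have hpos := orbitPt_sub_mul_pos h hc (n + 2) x
  rw [abs_orbitPt_sub_eq h hc, abs_orbitPt_sub_eq h hc]
  have hs0 := hc.sign n
  have hs1 := hc.sign (n + 1)
  have hs2 := hc.sign (n + 2)
  have hlt := hc.abs_lt_abs (n + 1)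
  rw [hc.abs_eq, hc.abs_eq] at hlt
  obtain ⟨k, hk, hq, hp⟩ := hc.recurrence n
  have hk' : (1 : ℝ) ≤ k := by exact_mod_cast hk
  rw [show (-1 : ℝ) ^ (n + 1 + 1) = (-1) ^ n by ring] at hlt
  rw [show (-1 : ℝ) ^ (n + 2) = (-1) ^ n by ring] at *
  rw [show (-1 : ℝ) ^ (n + 1) = -(-1) ^ n by ring] at *
  have hs := neg_one_pow_eq_or ℝ n
  set s := (-1 : ℝ) ^ n
  set gx := orbitPt F (q (n + 1)) (p (n + 1)) x with hgx
  set hx := orbitPt F (q (n + 2)) (p (n + 2)) x with hhx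
  have h1 : s * hx ≤ s * orbitPt F (q n) (p n) gx := by
    rw [hgx, hhx, h.orbitPt_orbitPt]
    refine h.mul_orbitPt_le hs ?_ x
    rw [hq, hp]
    push_cast
    nlinarith
  have h2 : s * orbitPt F (q (n + 1)) (p (n + 1)) hx ≤ s * x := by
    conv_rhs => rw [← orbitPt_zero F x]
    rw [hhx, h.orbitPt_orbitPt]
    refine h.mul_orbitPt_le hs ?_ x
    push_cast at hlt ⊢
    rw [show n + 1 + 1 = n + 2 from rfl] at hlt
    linarith
  obtain ⟨E₁, hE₁, -, he₁⟩ := exists_orbitPt_sub (p := p) hd hD n gx x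
  obtain ⟨E₂, hE₂, -, he₂⟩ := exists_orbitPt_sub (p := p) hd hD (n + 1) x hx
  rw [← hgx] at he₂
  have he0 := Real.exp_pos (-D)
  set e := Real.exp (-D)
  have h3 : e * (s * (hx - x)) ≤ s * (x - gx) := by
    have h31 : e * (s * (hx - x)) ≤ E₂ * (s * (hx - x)) :=
      mul_le_mul_of_nonneg_right hE₂ hpos.le
    have h32 : s * (orbitPt F (q (n + 1)) (p (n + 1)) hx - gx) = E₂ * (s * (hx - x)) := by
      rw [he₂]; ring
    linarith
  have h4 : e * (s * (x - gx)) ≤ s * (orbitPt F (q n) (p n) x - hx) := by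
    have h41 : e * (s * (x - gx)) ≤ E₁ * (s * (x - gx)) :=
      mul_le_mul_of_nonneg_right hE₁ (le_trans (by positivity) h3)
    have h42 : s * (orbitPt F (q n) (p n) x - orbitPt F (q n) (p n) gx) =
        E₁ * (s * (x - gx)) := by
      rw [he₁]; ring
    linarith
  have h5 := mul_le_mul_of_nonneg_left h3 he0.le
  rw [div_mul_eq_mul_div, one_mul, le_div_iff₀ (by positivity)]
  nlinarith

theorem abs_orbitPt_sub_succ_le (h : IrrationalLift F ρ) (hc : IsConvergents ρ p q)
    (hd : HasDistortionBounds F L w G C)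
    (hD : ∀ n x, |birkhoffSum F L (q n) x| ≤ D) (n : ℕ) (x : ℝ) :
    |orbitPt F (q (n + 1)) (p (n + 1)) x - x| ≤
      Real.exp D * |orbitPt F (q n) (p n) x - x| := by
  have hlt := hc.abs_lt_abs n
  rw [hc.abs_eq, hc.abs_eq] at hlt
  have hgpos := orbitPt_sub_mul_pos h hc (n + 1) x
  rw [abs_orbitPt_sub_eq h hc, abs_orbitPt_sub_eq h hc]
  rw [show (-1 : ℝ) ^ (n + 1) = -(-1) ^ n by ring] at *
  have hs := neg_one_pow_eq_or ℝ n
  set s := (-1 : ℝ) ^ n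
  set fx := orbitPt F (q n) (p n) x with hfx
  set gx := orbitPt F (q (n + 1)) (p (n + 1)) x with hgx
  have h1 : s * x ≤ s * orbitPt F (q n) (p n) gx := by
    conv_lhs => rw [← orbitPt_zero F x]
    rw [hgx, h.orbitPt_orbitPt]
    refine h.mul_orbitPt_le hs ?_ x
    push_cast
    linarith
  obtain ⟨E, hE, -, he⟩ := exists_orbitPt_sub (p := p) hd hD n gx x
  have h2 : Real.exp (-D) * (s * (x - gx)) ≤ E * (s * (x - gx)) :=
    mul_le_mul_of_nonneg_right hE (by linarith)
  have h3 : s * (fx - orbitPt F (q n) (p n) gx) = E * (s * (x - gx)) := by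
    rw [he]; ring
  have h4 : Real.exp (-D) * (s * (x - gx)) ≤ s * (fx - x) := by linarith
  rw [Real.exp_neg, inv_mul_le_iff₀ (Real.exp_pos _)] at h4
  linarith

theorem abs_orbitPt_sub_le_pow (h : IrrationalLift F ρ) (hc : IsConvergents ρ p q)
    (hd : HasDistortionBounds F L w G C)
    (hD : ∀ n x, |birkhoffSum F L (q n) x| ≤ D) (n : ℕ) (x : ℝ) :
    |orbitPt F (q n) (p n) x - x| ≤ (1 / (1 + Real.exp (-D) ^ 2)) ^ (n / 2) := by
  have hone : ∀ n, |orbitPt F (q n) (p n) x - x| ≤ 1 := by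
    intro n
    refine le_trans ?_ (h.sum_abs_iterate_sub_le_one (hc.isBestBefore n) x)
    exact Finset.single_le_sum (f := fun j => |F^[j] (orbitPt F (q n) (p n) x) - F^[j] x|)
      (fun j _ => abs_nonneg _) (Finset.mem_range.2 (hc.pos (n + 1)))
  induction n using Nat.twoStepInduction with
  | zero => simpa using hone 0
  | one => simpa using hone 1
  | more n ih _ =>
    rw [show (n + 2) / 2 = n / 2 + 1 by omega, pow_succ']
    exact (abs_orbitPt_sub_add_two_le h hc hd hD n x).trans
      (mul_le_mul_of_nonneg_left ih (by positivity))

/-- Divided differences of the `(n+1)`-st return map on the `n`-th return interval. -/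
theorem exists_orbitPt_slope_eq (h : IrrationalLift F ρ) (hc : IsConvergents ρ p q)
    (hd : HasDistortionBounds F L w G C) (hw : IsModulus w)
    {n : ℕ} {η : ℝ} (hη : ∀ y, |orbitPt F (q n) (p n) y - y| ≤ η) {x u v : ℝ}
    (hu : u ∈ uIcc x (orbitPt F (q n) (p n) x)) (hv : v ∈ uIcc x (orbitPt F (q n) (p n) x))
    (huv : u ≠ v) :
    ∃ e, |e| ≤ C * w η ∧
      orbitPt F (q (n + 1)) (p (n + 1)) v - orbitPt F (q (n + 1)) (p (n + 1)) u =
      Real.exp ((birkhoffSum F L (q (n + 1)) u + birkhoffSum F L (q (n + 1)) v) / 2 + e) *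
        (v - u) := by
  have hη0 : 0 < η := (abs_pos.2 (orbitPt_sub_ne_zero h hc n x)).trans_le (hη x)
  have hvu : v - u ≠ 0 := sub_ne_zero.2 huv.symm
  have hsum := (h.sum_abs_iterate_sub_le_of_mem (q (n + 1)) hu hv).trans
    (h.sum_abs_iterate_sub_le_one (hc.isBestBefore n) x)
  have hbd : ∀ j < q (n + 1), |F^[j] v - F^[j] u| ≤ η := by
    intro j _
    have hm := (h.strictMono_iterate j).monotone
    refine (abs_sub_le_of_uIcc_subset_uIcc
      (uIcc_subset_uIcc (hm.image_uIcc_subset (mem_image_of_mem _ hu))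
        (hm.image_uIcc_subset (mem_image_of_mem _ hv)))).trans ?_
    have e : F^[j] (orbitPt F (q n) (p n) x) = orbitPt F (q n) (p n) (F^[j] x) := by
      simp only [orbitPt, h.iterate_sub_int, ← Function.iterate_add_apply, add_comm]
    rw [e]
    exact hη _
  refine ⟨_, hd.abs_log_slope_iterate_le hw h.strictMono huv hsum hbd hη0, ?_⟩
  have hslope : 0 < (F^[q (n + 1)] v - F^[q (n + 1)] u) / (v - u) := by
    obtain ⟨c, hc'⟩ := hd.exists_iterate_sub (q (n + 1)) u v
    rw [hc', mul_div_cancel_right₀ _ hvu]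
    exact Real.exp_pos _
  rw [add_sub_cancel, Real.exp_log hslope, div_mul_cancel₀ _ hvu]
  simp only [orbitPt]; ring

end Returns

/-- The Dini condition implies summability of the modulus along geometric sequences. -/
theorem IsModulus.summable_pow {w : ℝ → ℝ} (hw : IsModulus w)
    (hDini : IntegrableOn (fun y : ℝ => w y / y) (Ioc 0 1)) {r : ℝ} (hr0 : 0 < r) (hr1 : r < 1) :
    Summable fun n : ℕ => w (r ^ n) := by
  have hle1 : ∀ n : ℕ, r ^ n ≤ 1 := fun n => pow_le_one₀ hr0.le hr1.le
  have hle : ∀ n : ℕ, r ^ (n + 1) ≤ r ^ n := fun n => pow_le_pow_of_le_one hr0.le hr1.le n.le_succ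
  have hii : ∀ {a b : ℝ}, 0 < a → a ≤ b → b ≤ 1 →
      IntervalIntegrable (fun y => w y / y) volume a b := fun ha hab hb =>
    (intervalIntegrable_iff_integrableOn_Ioc_of_le hab).2
      (hDini.mono_set (Ioc_subset_Ioc ha.le hb))
  have hstep : ∀ n : ℕ, (1 - r) * w (r ^ (n + 1)) ≤ ∫ y in r ^ (n + 1)..r ^ n, w y / y := by
    intro n
    have hn := pow_pos hr0 n
    have hn1 := pow_pos hr0 (n + 1)
    have h1 : ∫ _ in r ^ (n + 1)..r ^ n, w (r ^ (n + 1)) / r ^ n ≤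
        ∫ y in r ^ (n + 1)..r ^ n, w y / y := by
      refine intervalIntegral.integral_mono_on (hle n) (by simp) (hii hn1 (hle n) (hle1 n)) ?_
      intro y hy
      have hy0 := hn1.trans_le hy.1
      exact div_le_div₀ (hw.pos y hy0).le (hw.mono hn1 hy.1) hy0 hy.2
    rw [intervalIntegral.integral_const, smul_eq_mul] at h1
    refine le_trans (le_of_eq ?_) h1
    rw [pow_succ]
    field_simp
  have hsum : ∀ N : ℕ, ∑ n ∈ Finset.range N, (1 - r) * w (r ^ (n + 1)) ≤
      ∫ y in r ^ N..1, w y / y := by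
    intro N
    induction N with
    | zero => simp
    | succ N ih =>
      rw [Finset.sum_range_succ, ← intervalIntegral.integral_add_adjacent_intervals
        (hii (pow_pos hr0 _) (hle N) (hle1 N)) (hii (pow_pos hr0 N) (hle1 N) le_rfl)]
      linarith [hstep N]
  rw [← summable_nat_add_iff 1]
  refine summable_of_sum_range_le (c := (∫ y in Ioc (0 : ℝ) 1, w y / y) / (1 - r))
    (fun n => (hw.pos _ (pow_pos hr0 _)).le) fun N => ?_
  rw [le_div_iff₀ (by linarith), mul_comm, Finset.mul_sum]
  refine (hsum N).trans ?_
  rw [intervalIntegral.integral_of_le (hle1 N)]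
  refine setIntegral_mono_set hDini ?_
    (LE.le.eventuallyLE (Ioc_subset_Ioc_left (pow_pos hr0 N).le))
  filter_upwards [ae_restrict_mem measurableSet_Ioc] with y hy
  exact div_nonneg (hw.pos y hy.1).le hy.1.le

theorem IsModulus.summable_pow_half {w : ℝ → ℝ} (hw : IsModulus w)
    (hDini : IntegrableOn (fun y : ℝ => w y / y) (Ioc 0 1)) {r : ℝ} (hr0 : 0 < r) (hr1 : r < 1) :
    Summable fun n : ℕ => w (r ^ (n / 2)) := by
  have hs := (hw.summable_pow hDini hr0 hr1).hasSum
  have h0 : ∀ k : ℕ, 2 * k / 2 = k := by omega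
  have h1 : ∀ k : ℕ, (2 * k + 1) / 2 = k := by omega
  exact (HasSum.even_add_odd (f := fun n : ℕ => w (r ^ (n / 2))) (by simpa only [h0] using hs)
    (by simpa only [h1] using hs)).summable

theorem abs_exp_add_sub_exp_le {y e D d₀ : ℝ} (hy : |y| ≤ D) (he : |e| ≤ d₀) :
    |Real.exp (y + e) - Real.exp y| ≤ Real.exp (D + d₀) * |e| := by
  have h1 : |Real.exp e - 1| ≤ Real.exp |e| * |e| := by
    have ha := Real.add_one_le_exp e
    have hb := Real.add_one_le_exp (-e)
    have hc : Real.exp e * Real.exp (-e) = 1 := by rw [← Real.exp_add]; simp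
    have hp := Real.exp_pos e
    have hpa := Real.one_le_exp (abs_nonneg e)
    have hea := Real.exp_le_exp.2 (le_abs_self e)
    rw [abs_le]
    constructor
    · nlinarith [neg_abs_le e, abs_nonneg e]
    · have : Real.exp e - 1 ≤ Real.exp e * e := by nlinarith
      calc Real.exp e - 1 ≤ Real.exp e * e := this
        _ ≤ Real.exp e * |e| := mul_le_mul_of_nonneg_left (le_abs_self e) hp.le
        _ ≤ _ := mul_le_mul_of_nonneg_right hea (abs_nonneg e)
  have h2 : Real.exp (y + e) - Real.exp y = Real.exp y * (Real.exp e - 1) := by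
    rw [Real.exp_add]; ring
  rw [h2, abs_mul, abs_of_pos (Real.exp_pos y), Real.exp_add, mul_assoc]
  refine mul_le_mul (Real.exp_le_exp.2 ((le_abs_self y).trans hy)) (h1.trans ?_) (abs_nonneg _)
    (Real.exp_pos _).le
  exact mul_le_mul_of_nonneg_right (Real.exp_le_exp.2 he) (abs_nonneg e)

theorem abs_le_exp_mul_abs_exp_sub_one {y D : ℝ} (hy : |y| ≤ D) :
    |y| ≤ Real.exp D * |Real.exp y - 1| := by
  have h1 := Real.add_one_le_exp y
  have h2 := Real.add_one_le_exp (-y)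
  have h3 : Real.exp y * Real.exp (-y) = 1 := by rw [← Real.exp_add]; simp
  obtain ⟨h4, h5⟩ := abs_le.1 hy
  have h6 : Real.exp (-y) ≤ Real.exp D := Real.exp_le_exp.2 (by linarith)
  have h7 : 1 ≤ Real.exp D := Real.one_le_exp ((abs_nonneg y).trans hy)
  have hp := Real.exp_pos (-y)
  rcases le_total 0 y with h0 | h0
  · rw [abs_of_nonneg h0, abs_of_nonneg (by linarith)]
    nlinarith
  · have : Real.exp y ≤ 1 := Real.exp_le_one_iff.2 h0
    rw [abs_of_nonpos h0, abs_of_nonpos (by linarith)]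
    nlinarith

/-- Stability of the relation `e ^ y - 1 = t * (e ^ z - 1)` under perturbations of the exponents. -/
theorem abs_exp_sub_one_le_of_eq {y z t e₁ e₂ d d₀ D : ℝ} (hy : |y| ≤ D) (hz : |z| ≤ D)
    (h1 : |e₁| ≤ d) (h2 : |e₂| ≤ d) (hd : d ≤ d₀)
    (heq : Real.exp (y + e₁) - 1 = t * (Real.exp (z + e₂) - 1)) :
    |Real.exp y - 1| ≤ |t| * |Real.exp z - 1| + Real.exp (D + d₀) * (1 + |t|) * d := by
  have ha := abs_exp_add_sub_exp_le hy (h1.trans hd)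
  have hb := abs_exp_add_sub_exp_le hz (h2.trans hd)
  have hE := Real.exp_pos (D + d₀)
  set E := Real.exp (D + d₀)
  have e : Real.exp y - 1 = t * (Real.exp z - 1) + t * (Real.exp (z + e₂) - Real.exp z) -
      (Real.exp (y + e₁) - Real.exp y) := by linear_combination heq
  calc |Real.exp y - 1| ≤ |t * (Real.exp z - 1)| + |t * (Real.exp (z + e₂) - Real.exp z)| +
        |Real.exp (y + e₁) - Real.exp y| := by
        rw [e]; exact (abs_sub _ _).trans (add_le_add_left (abs_add_le _ _) _)
    _ ≤ |t| * |Real.exp z - 1| + |t| * (E * d) + E * d := by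
        rw [abs_mul, abs_mul]
        have := mul_le_mul_of_nonneg_left h1 hE.le
        have := mul_le_mul_of_nonneg_left h2 hE.le
        have := mul_le_mul_of_nonneg_left (hb.trans this) (abs_nonneg t)
        linarith
    _ = _ := by ring

/-- A sequence of functions satisfying a contracting linear recursion with summable error is
dominated by a summable sequence. -/
theorem exists_summable_of_recursion {X : Type*} [Nonempty X] {u : ℕ → X → ℝ} {B r : ℝ}
    {c : ℕ → ℝ} (s : ℕ) (hu : ∀ n x, 0 ≤ u n x) (hB : ∀ n x, u n x ≤ B) (hr0 : 0 ≤ r) (hr1 : r < 1)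
    (hc : Summable c) (hc0 : ∀ n, 0 ≤ c n) (hrec : ∀ n x, u (n + s) x ≤ r * u n x + c n) :
    ∃ σ : ℕ → ℝ, Summable σ ∧ (∀ n, 0 ≤ σ n) ∧ ∀ n x, u n x ≤ σ n := by
  have hbdd : ∀ n, BddAbove (range (u n)) := fun n => ⟨B, by rintro _ ⟨x, rfl⟩; exact hB n x⟩
  have hσ : ∀ n x, u n x ≤ ⨆ x, u n x := fun n x => le_ciSup (hbdd n) x
  have hσ0 : ∀ n, 0 ≤ ⨆ x, u n x := fun n => (hu n (Classical.arbitrary X)).trans (hσ n _)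
  refine ⟨fun n => ⨆ x, u n x, ?_, hσ0, hσ⟩
  have hrec' : ∀ n, (⨆ x, u (n + s) x) ≤ r * (⨆ x, u n x) + c n := fun n =>
    ciSup_le fun x => (hrec n x).trans (by gcongr; exact hσ n x)
  set σ : ℕ → ℝ := fun n => ⨆ x, u n x
  refine summable_of_sum_range_le (c := (∑ n ∈ Finset.range s, σ n + ∑' n, c n) / (1 - r)) hσ0
    fun N => ?_
  rw [le_div_iff₀ (by linarith)]
  have h1 : ∑ n ∈ Finset.range N, σ n ≤ ∑ n ∈ Finset.range (s + N), σ n :=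
    Finset.sum_le_sum_of_subset_of_nonneg (Finset.range_mono (by omega)) fun n _ _ => hσ0 n
  rw [Finset.sum_range_add] at h1
  have h2 : ∑ n ∈ Finset.range N, σ (s + n) ≤ r * ∑ n ∈ Finset.range N, σ n + ∑' n, c n := by
    calc ∑ n ∈ Finset.range N, σ (s + n) ≤ ∑ n ∈ Finset.range N, (r * σ n + c n) :=
          Finset.sum_le_sum fun n _ => by rw [add_comm]; exact hrec' n
      _ ≤ _ := by
          rw [Finset.sum_add_distrib, ← Finset.mul_sum]
          gcongr
          exact hc.sum_le_tsum _ fun n _ => hc0 n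
  linarith

theorem IrrationalLift.birkhoffSum_sub_birkhoffSum_orbitPt {F L : ℝ → ℝ} {ρ : ℝ}
    (h : IrrationalLift F ρ) (hper : ∀ (x : ℝ) (a : ℤ), L (x - a) = L x) (M N : ℕ) (a b : ℤ)
    (x : ℝ) :
    birkhoffSum F L M x - birkhoffSum F L M (orbitPt F N b x) =
      birkhoffSum F L N x - birkhoffSum F L N (orbitPt F M a x) := by
  rw [orbitPt, orbitPt, h.birkhoffSum_sub_int hper, h.birkhoffSum_sub_int hper]
  have h1 := birkhoffSum_add F L M N x
  have h2 := birkhoffSum_add F L N M x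
  rw [add_comm N M] at h2
  linarith

section Recursions

variable {F L w : ℝ → ℝ} {ρ G C D : ℝ} {p : ℕ → ℤ} {q : ℕ → ℕ} {η : ℕ → ℝ}

theorem orbitPt_mem_uIcc (h : IrrationalLift F ρ) (hc : IsConvergents ρ p q)
    (hd : HasDistortionBounds F L w G C) (hD : ∀ n x, |birkhoffSum F L (q n) x| ≤ D)
    (n : ℕ) (x : ℝ) :
    orbitPt F (q (n + 2)) (p (n + 2)) x ∈ uIcc x (orbitPt F (q n) (p n) x) := by
  have h1 := orbitPt_sub_mul_pos h hc n x
  have h2 := orbitPt_sub_mul_pos h hc (n + 2) x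
  have h3 := abs_orbitPt_sub_add_two_le h hc hd hD n x
  have h4 : 1 / (1 + Real.exp (-D) ^ 2) ≤ 1 := by
    rw [div_le_one (by positivity)]
    linarith [sq_nonneg (Real.exp (-D))]
  replace h3 := h3.trans (mul_le_of_le_one_left (abs_nonneg _) h4)
  rw [abs_orbitPt_sub_eq h hc, abs_orbitPt_sub_eq h hc] at h3
  rw [show (-1 : ℝ) ^ (n + 2) = (-1) ^ n by ring] at *
  rw [mem_uIcc]
  rcases neg_one_pow_eq_or ℝ n with he | he <;> rw [he] at h1 h2 h3
  · left; constructor <;> linarith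
  · right; constructor <;> linarith

/-- The variations of the log-derivatives along one generation contract, up to the distortion
error of that generation. -/
theorem abs_exp_half_variation_le (h : IrrationalLift F ρ) (hc : IsConvergents ρ p q)
    (hd : HasDistortionBounds F L w G C) (hw : IsModulus w)
    (hD : ∀ n x, |birkhoffSum F L (q n) x| ≤ D)
    (hη : ∀ n y, |orbitPt F (q n) (p n) y - y| ≤ η n) {d₀ : ℝ} {n : ℕ}
    (hd₀ : 2 * (C * w (η n)) ≤ d₀) (x : ℝ) :
    |Real.exp ((birkhoffSum F L (q (n + 2)) x -
        birkhoffSum F L (q (n + 2)) (orbitPt F (q (n + 1)) (p (n + 1)) x)) / 2) - 1| ≤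
      1 / (1 + Real.exp (-D) ^ 2) * |Real.exp ((birkhoffSum F L (q (n + 1)) x -
        birkhoffSum F L (q (n + 1)) (orbitPt F (q n) (p n) x)) / 2) - 1| +
      Real.exp (D + d₀) * 2 * (2 * (C * w (η n))) := by
  have hl1 : 1 / (1 + Real.exp (-D) ^ 2) < 1 := by
    rw [div_lt_one (by positivity)]
    linarith [pow_pos (Real.exp_pos (-D)) 2]
  have hr := orbitPt_mem_uIcc h hc hd hD n x
  have hba := orbitPt_sub_ne_zero h hc n x
  have hra := orbitPt_sub_ne_zero h hc (n + 2) x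
  have hlt := abs_orbitPt_sub_add_two_le h hc hd hD n x
  rw [h.birkhoffSum_sub_birkhoffSum_orbitPt hd.periodic (q (n + 2)) (q (n + 1)) (p (n + 2))]
  have hA1 : ∀ y : ℝ, |(birkhoffSum F L (q (n + 1)) x - birkhoffSum F L (q (n + 1)) y) / 2| ≤ D :=
    fun y => by
      rw [abs_div, abs_two, div_le_iff₀ two_pos]
      exact (abs_sub _ _).trans (by linarith [hD (n + 1) x, hD (n + 1) y])
  have ht : |(orbitPt F (q (n + 2)) (p (n + 2)) x - x) / (orbitPt F (q n) (p n) x - x)| ≤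
      1 / (1 + Real.exp (-D) ^ 2) := by
    rwa [abs_div, div_le_iff₀ (abs_pos.2 hba)]
  have hne : orbitPt F (q (n + 2)) (p (n + 2)) x ≠ orbitPt F (q n) (p n) x := by
    intro he
    rw [he] at hlt
    nlinarith [abs_pos.2 hba]
  obtain ⟨e₁, he₁, h₁⟩ := exists_orbitPt_slope_eq h hc hd hw (hη n) left_mem_uIcc right_mem_uIcc
    (sub_ne_zero.1 hba).symm
  obtain ⟨e₂, he₂, h₂⟩ := exists_orbitPt_slope_eq h hc hd hw (hη n) left_mem_uIcc hr
    (sub_ne_zero.1 hra).symm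
  obtain ⟨e₃, he₃, h₃⟩ := exists_orbitPt_slope_eq h hc hd hw (hη n) hr right_mem_uIcc hne
  set r := orbitPt F (q (n + 2)) (p (n + 2)) x
  set b := orbitPt F (q n) (p n) x
  set Λ := birkhoffSum F L (q (n + 1))
  refine (abs_exp_sub_one_le_of_eq (hA1 r) (hA1 b) (e₁ := e₁ - e₃) (e₂ := e₂ - e₃)
    (t := (r - x) / (b - x)) (d := 2 * (C * w (η n))) (d₀ := d₀)
    ((abs_sub _ _).trans (by linarith)) ((abs_sub _ _).trans (by linarith)) hd₀ ?_).trans ?_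
  · rw [show (Λ x - Λ r) / 2 + (e₁ - e₃) = ((Λ x + Λ b) / 2 + e₁) - ((Λ r + Λ b) / 2 + e₃) by ring,
      show (Λ x - Λ b) / 2 + (e₂ - e₃) = ((Λ x + Λ r) / 2 + e₂) - ((Λ r + Λ b) / 2 + e₃) by ring,
      Real.exp_sub, Real.exp_sub]
    have h3 := Real.exp_pos ((Λ r + Λ b) / 2 + e₃)
    generalize Real.exp ((Λ x + Λ b) / 2 + e₁) = E₁ at *
    generalize Real.exp ((Λ x + Λ r) / 2 + e₂) = E₂ at *
    generalize Real.exp ((Λ r + Λ b) / 2 + e₃) = E₃ at *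
    field_simp
    linear_combination h₂ + h₃ - h₁
  · have : 0 ≤ 2 * (C * w (η n)) := by linarith [(abs_nonneg e₁).trans he₁]
    gcongr
    linarith

/-- Comparison of the log-derivatives at two consecutive closest return times. -/
theorem abs_exp_birkhoffSum_sub_one_le (h : IrrationalLift F ρ) (hc : IsConvergents ρ p q)
    (hd : HasDistortionBounds F L w G C) (hw : IsModulus w)
    (hD : ∀ n x, |birkhoffSum F L (q n) x| ≤ D)
    (hη : ∀ n y, |orbitPt F (q n) (p n) y - y| ≤ η n) {d d₀ : ℝ} {n : ℕ} (x : ℝ)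
    (hn : |(birkhoffSum F L (q (n + 2)) x -
        birkhoffSum F L (q (n + 2)) (orbitPt F (q (n + 1)) (p (n + 1)) x)) / 2| +
      (C * w (η n) + C * w (η (n + 1))) ≤ d) (hd₀ : d ≤ d₀) :
    |Real.exp (birkhoffSum F L (q (n + 2)) x) - 1| ≤
      |(orbitPt F (q (n + 2)) (p (n + 2)) x - x) / (orbitPt F (q (n + 1)) (p (n + 1)) x - x)| *
        |Real.exp (birkhoffSum F L (q (n + 1)) x) - 1| +
      Real.exp (D + d₀) *
        (1 + |(orbitPt F (q (n + 2)) (p (n + 2)) x - x) /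
          (orbitPt F (q (n + 1)) (p (n + 1)) x - x)|) * d := by
  have hra := orbitPt_sub_ne_zero h hc (n + 2) x
  have hba := orbitPt_sub_ne_zero h hc (n + 1) x
  obtain ⟨e₁, he₁, h₁⟩ := exists_orbitPt_slope_eq h hc hd hw (hη (n + 1)) left_mem_uIcc
    right_mem_uIcc (sub_ne_zero.1 hba).symm
  obtain ⟨e₂, he₂, h₂⟩ := exists_orbitPt_slope_eq h hc hd hw (hη n) left_mem_uIcc
    (orbitPt_mem_uIcc h hc hd hD n x) (sub_ne_zero.1 hra).symm
  have hcomm := h.birkhoffSum_sub_birkhoffSum_orbitPt hd.periodic (q (n + 2)) (q (n + 1))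
    (p (n + 2)) (p (n + 1)) x
  have hP : orbitPt F (q (n + 2)) (p (n + 2)) (orbitPt F (q (n + 1)) (p (n + 1)) x) =
      orbitPt F (q (n + 1)) (p (n + 1)) (orbitPt F (q (n + 2)) (p (n + 2)) x) := by
    rw [h.orbitPt_orbitPt, h.orbitPt_orbitPt, add_comm (q _), add_comm (p _)]
  rw [show n + 1 + 1 = n + 2 from rfl, hP] at h₁
  rw [show n + 1 + 1 = n + 2 from rfl] at *
  have hy := hD (n + 2) x
  have hz := hD (n + 1) x
  set r := orbitPt F (q (n + 2)) (p (n + 2)) x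
  set b := orbitPt F (q (n + 1)) (p (n + 1)) x
  set y := birkhoffSum F L (q (n + 2)) x
  set z := birkhoffSum F L (q (n + 1)) x
  set yb := birkhoffSum F L (q (n + 2)) b
  set zr := birkhoffSum F L (q (n + 1)) r
  have hsmall : ∀ i, 0 ≤ C * w (η i) := fun i => mul_nonneg hd.const_nonneg
    (hw.pos _ ((abs_pos.2 (orbitPt_sub_ne_zero h hc i x)).trans_le (hη i x))).le
  refine abs_exp_sub_one_le_of_eq hy hz (e₁ := e₁ - (y - yb) / 2) (e₂ := e₂ - (y - yb) / 2)
    ((abs_sub _ _).trans ?_) ((abs_sub _ _).trans ?_) hd₀ ?_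
  · linarith [hsmall n]
  · linarith [hsmall (n + 1)]
  · rw [show y + (e₁ - (y - yb) / 2) = (y + yb) / 2 + e₁ by ring,
      show z + (e₂ - (y - yb) / 2) = (z + zr) / 2 + e₂ by rw [hcomm]; ring]
    generalize Real.exp ((y + yb) / 2 + e₁) = E₁ at *
    generalize Real.exp ((z + zr) / 2 + e₂) = E₂ at *
    field_simp
    linear_combination h₂ - h₁

end Recursions

theorem abs_exp_sub_one_le_of_abs_le {y D : ℝ} (hy : |y| ≤ D) :
    |Real.exp y - 1| ≤ Real.exp D + 1 := by
  have h1 := Real.exp_le_exp.2 ((le_abs_self y).trans hy)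
  refine (abs_sub _ _).trans ?_
  rw [abs_one, abs_of_pos (Real.exp_pos y)]
  linarith

/-- Under the Dini condition the log-derivatives at closest return times are summable. -/
theorem exists_summable_abs_birkhoffSum_le {F L w : ℝ → ℝ} {ρ G C : ℝ} {p : ℕ → ℤ} {q : ℕ → ℕ}
    (h : IrrationalLift F ρ) (hc : IsConvergents ρ p q) (hd : HasDistortionBounds F L w G C)
    (hw : IsModulus w) (hDini : IntegrableOn (fun y : ℝ => w y / y) (Ioc 0 1)) :
    ∃ σ : ℕ → ℝ, Summable σ ∧ (∀ n, 0 ≤ σ n) ∧ ∀ n x, |birkhoffSum F L (q n) x| ≤ σ n := by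
  obtain ⟨D, hD⟩ := h.exists_uniform_bound hc hd
  have hr0 : 0 < 1 / (1 + Real.exp (-D) ^ 2) := by positivity
  have hr1 : 1 / (1 + Real.exp (-D) ^ 2) < 1 := by
    rw [div_lt_one (by positivity)]
    linarith [pow_pos (Real.exp_pos (-D)) 2]
  have hη := abs_orbitPt_sub_le_pow h hc hd hD
  have hδ := (hw.summable_pow_half hDini hr0 hr1).mul_left C
  have hδ0 : ∀ n, 0 ≤ C * w ((1 / (1 + Real.exp (-D) ^ 2)) ^ (n / 2)) := fun n =>
    mul_nonneg hd.const_nonneg (hw.pos _ (pow_pos hr0 _)).le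
  have hrec₁ := fun n => abs_exp_half_variation_le h hc hd hw hD hη (n := n)
    (mul_le_mul_of_nonneg_left (hδ.le_tsum n fun j _ => hδ0 j) zero_le_two)
  have hrec₂ := fun n x d d₀ => abs_exp_birkhoffSum_sub_one_le h hc hd hw hD hη (n := n)
    (d := d) (d₀ := d₀) x
  have hstep := abs_orbitPt_sub_add_two_le h hc hd hD
  generalize 1 / (1 + Real.exp (-D) ^ 2) = r at *
  generalize hδdef : (fun n : ℕ => C * w (r ^ (n / 2))) = δ at *
  have hδn : ∀ n : ℕ, C * w (r ^ (n / 2)) = δ n := fun n => congrFun hδdef n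
  simp only [hδn] at *
  have hA : ∀ n x, |(birkhoffSum F L (q (n + 1)) x -
      birkhoffSum F L (q (n + 1)) (orbitPt F (q n) (p n) x)) / 2| ≤ D := fun n x => by
    rw [abs_div, abs_two, div_le_iff₀ two_pos]
    exact (abs_sub _ _).trans
      (by linarith [hD (n + 1) x, hD (n + 1) (orbitPt F (q n) (p n) x)])
  obtain ⟨α, hα, hα0, hle⟩ := exists_summable_of_recursion 1
    (u := fun n x => |Real.exp ((birkhoffSum F L (q (n + 1)) x -
      birkhoffSum F L (q (n + 1)) (orbitPt F (q n) (p n) x)) / 2) - 1|)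
    (fun _ _ => abs_nonneg _) (fun n x => abs_exp_sub_one_le_of_abs_le (hA n x)) hr0.le hr1
    ((hδ.mul_left 2).mul_left (Real.exp (D + 2 * ∑' n, δ n) * 2))
    (fun n => mul_nonneg (by positivity) (mul_nonneg zero_le_two (hδ0 n))) hrec₁
  have hvar : ∀ n x, |(birkhoffSum F L (q (n + 1)) x -
      birkhoffSum F L (q (n + 1)) (orbitPt F (q n) (p n) x)) / 2| ≤ Real.exp D * α n :=
    fun n x => (abs_le_exp_mul_abs_exp_sub_one (hA n x)).trans
      (mul_le_mul_of_nonneg_left (hle n x) (Real.exp_pos D).le)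
  obtain ⟨d, hdd⟩ : ∃ d : ℕ → ℝ, d = fun n => Real.exp D * α (n + 1) + (δ n + δ (n + 1)) :=
    ⟨_, rfl⟩
  have hds : Summable d := by
    rw [hdd]
    exact (((summable_nat_add_iff 1).2 hα).mul_left _).add
      (hδ.add ((summable_nat_add_iff 1).2 hδ))
  have hd0 : ∀ n, 0 ≤ d n := fun n => by
    rw [hdd]
    exact add_nonneg (mul_nonneg (Real.exp_pos D).le (hα0 _)) (add_nonneg (hδ0 _) (hδ0 _))
  have hβ := fun n x => hrec₂ n x (d n) (∑' n, d n)
    (by rw [hdd]; exact add_le_add_left (hvar (n + 1) x) _) (hds.le_tsum n fun j _ => hd0 j)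
  have hE := Real.exp_pos (D + ∑' n, d n)
  generalize Real.exp (D + ∑' n, d n) = E at *
  have hM := Real.exp_pos D
  have hτ : ∀ n x, |(orbitPt F (q (n + 2)) (p (n + 2)) x - x) /
      (orbitPt F (q (n + 1)) (p (n + 1)) x - x)| ≤ Real.exp D := fun n x => by
    rw [abs_div, div_le_iff₀ (abs_pos.2 (orbitPt_sub_ne_zero h hc (n + 1) x))]
    exact abs_orbitPt_sub_succ_le h hc hd hD (n + 1) x
  have hττ : ∀ n x, |(orbitPt F (q (n + 3)) (p (n + 3)) x - x) /
        (orbitPt F (q (n + 2)) (p (n + 2)) x - x)| *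
      |(orbitPt F (q (n + 2)) (p (n + 2)) x - x) /
        (orbitPt F (q (n + 1)) (p (n + 1)) x - x)| ≤ r := fun n x => by
    rw [← abs_mul, div_mul_div_cancel₀ (orbitPt_sub_ne_zero h hc (n + 2) x), abs_div,
      div_le_iff₀ (abs_pos.2 (orbitPt_sub_ne_zero h hc (n + 1) x))]
    exact hstep (n + 1) x
  obtain ⟨β, hβs, hβ0, hβle⟩ := exists_summable_of_recursion 2
    (u := fun n x => |Real.exp (birkhoffSum F L (q (n + 1)) x) - 1|)
    (c := fun n => Real.exp D * (E * (1 + Real.exp D) * d n) + E * (1 + Real.exp D) * d (n + 1))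
    (fun _ _ => abs_nonneg _) (fun n x => abs_exp_sub_one_le_of_abs_le (hD (n + 1) x)) hr0.le hr1
    (((hds.mul_left _).mul_left _).add (((summable_nat_add_iff 1).2 hds).mul_left _))
    (fun n => by have := hd0 n; have := hd0 (n + 1); positivity) fun n x => by
      have h1 := hβ n x
      have h2 := hβ (n + 1) x
      have t1 := hτ n x
      have t2 := hτ (n + 1) x
      have t3 := hττ n x
      simp only [show n + 1 + 2 = n + 3 from rfl, show n + 1 + 1 = n + 2 from rfl] at *
      have T1 := abs_nonneg ((orbitPt F (q (n + 2)) (p (n + 2)) x - x) /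
        (orbitPt F (q (n + 1)) (p (n + 1)) x - x))
      have T2 := abs_nonneg ((orbitPt F (q (n + 3)) (p (n + 3)) x - x) /
        (orbitPt F (q (n + 2)) (p (n + 2)) x - x))
      generalize |(orbitPt F (q (n + 3)) (p (n + 3)) x - x) /
        (orbitPt F (q (n + 2)) (p (n + 2)) x - x)| = T₂ at *
      generalize |(orbitPt F (q (n + 2)) (p (n + 2)) x - x) /
        (orbitPt F (q (n + 1)) (p (n + 1)) x - x)| = T₁ at *
      have hd1 := hd0 n
      have hd2 := hd0 (n + 1)
      calc _ ≤ _ := h2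
        _ ≤ T₂ * (T₁ * |Real.exp (birkhoffSum F L (q (n + 1)) x) - 1| + E * (1 + T₁) * d n) +
            E * (1 + T₂) * d (n + 1) := by gcongr
        _ = (T₂ * T₁) * |Real.exp (birkhoffSum F L (q (n + 1)) x) - 1| +
            (T₂ * (E * (1 + T₁) * d n) + E * (1 + T₂) * d (n + 1)) := by ring
        _ ≤ _ := by gcongr
  refine ⟨fun n => Nat.casesOn n D fun n => Real.exp D * β n, ?_, fun n => ?_, fun n x => ?_⟩
  · rw [← summable_nat_add_iff 1]
    exact hβs.mul_left _
  · cases n with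
    | zero => exact (abs_nonneg _).trans (hD 0 0)
    | succ n => exact mul_nonneg hM.le (hβ0 n)
  · cases n with
    | zero => exact hD 0 x
    | succ n =>
      exact (abs_le_exp_mul_abs_exp_sub_one (hD (n + 1) x)).trans
        (mul_le_mul_of_nonneg_left (hβle n x) hM.le)

section Transfer

variable {F L w : ℝ → ℝ} {ρ G C : ℝ} {p : ℕ → ℤ} {q : ℕ → ℕ} {σ : ℕ → ℝ} {K : ℕ}

theorem abs_birkhoffSum_mul_le {N : ℕ} {s : ℝ} (hs : ∀ x, |birkhoffSum F L N x| ≤ s) (b : ℕ)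
    (x : ℝ) : |birkhoffSum F L (b * N) x| ≤ b * s := by
  induction b with
  | zero => simp
  | succ b ih =>
    rw [add_mul, one_mul, birkhoffSum_add]
    push_cast
    linarith [abs_add_le (birkhoffSum F L (b * N) x) (birkhoffSum F L N (F^[b * N] x)),
      hs (F^[b * N] x)]

/-- Greedy expansion of a time `N` along the closest return times `q m, ..., q (n - 1)`. -/
theorem exists_eq_add_of_lt (hpos : ∀ n, 0 < q n) (hK : ∀ n, q (n + 1) ≤ (K + 1) * q n)
    (hσ : ∀ n x, |birkhoffSum F L (q n) x| ≤ σ n) {m n : ℕ} (hmn : m ≤ n) :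
    ∀ N < q n, ∃ i < q m, ∃ j, N = i + j ∧
      ∀ x, |birkhoffSum F L j x| ≤ (K + 1) * ∑ l ∈ Finset.Ico m n, σ l := by
  induction n, hmn using Nat.le_induction with
  | base => exact fun N hN => ⟨N, hN, 0, by simp⟩
  | succ n hmn ih =>
    intro N hN
    obtain ⟨i, hi, j, hij, hj⟩ := ih (N % q n) (Nat.mod_lt _ (hpos n))
    refine ⟨i, hi, j + N / q n * q n, ?_, fun x => ?_⟩
    · rw [← add_assoc, ← hij, Nat.mod_add_div']
    · have hb : ((N / q n : ℕ) : ℝ) ≤ K + 1 := by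
        exact_mod_cast (Nat.div_lt_of_lt_mul
          (lt_of_lt_of_le hN ((hK n).trans_eq (mul_comm _ _)))).le
      have h1 := abs_birkhoffSum_mul_le (hσ n) (N / q n) (F^[j] x)
      have h2 := mul_le_mul_of_nonneg_right hb ((abs_nonneg _).trans (hσ n x))
      rw [birkhoffSum_add, Finset.sum_Ico_succ_top hmn]
      linarith [hj x, abs_add_le (birkhoffSum F L j x)
        (birkhoffSum F L (N / q n * q n) (F^[j] x))]

/-- Summable log-derivatives along closest returns make `L` a continuous coboundary when the
partial quotients are bounded. -/
theorem exists_continuous_transfer (h : IrrationalLift F ρ) (hc : IsConvergents ρ p q)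
    (hd : HasDistortionBounds F L w G C) (hK : ∀ n, q (n + 1) ≤ (K + 1) * q n)
    (hσs : Summable σ) (hσ0 : ∀ n, 0 ≤ σ n) (hσ : ∀ n x, |birkhoffSum F L (q n) x| ≤ σ n) :
    ∃ ψ : ℝ → ℝ, Continuous ψ ∧ (∀ x, ψ (x + 1) = ψ x) ∧ ∀ x, ψ (F x) + L x = ψ x := by
  set T : ℕ → ℝ := fun m => (K + 1) * ∑' l, σ (l + m) with hT
  have hT0 : Tendsto T atTop (𝓝 0) := by
    simpa using (tendsto_sum_nat_add σ).const_mul ((K : ℝ) + 1)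
  have hne : ∀ m, (Finset.range (q m)).Nonempty := fun m =>
    Finset.nonempty_range_iff.2 (hc.pos m).ne'
  set φ : ℕ → ℝ → ℝ := fun m x => (Finset.range (q m)).sup' (hne m) fun i => birkhoffSum F L i x
    with hφ
  have hle : ∀ m x N, birkhoffSum F L N x ≤ φ m x + T m := by
    intro m x N
    have hN : N < q (N + m + 2) := by
      have : N + m + 1 < q (N + m + 2) + 1 := hc.lt_add_two (N + m + 1)
      omega
    obtain ⟨i, hi, j, rfl, hj⟩ := exists_eq_add_of_lt hc.pos hK hσ (m := m) (by omega) N hN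
    rw [birkhoffSum_add]
    refine add_le_add (Finset.le_sup' (fun i => birkhoffSum F L i x) (Finset.mem_range.2 hi))
      ((le_abs_self _).trans ((hj _).trans ?_))
    refine mul_le_mul_of_nonneg_left ?_ (by positivity)
    rw [Finset.sum_Ico_eq_sum_range]
    simp only [add_comm m]
    exact ((summable_nat_add_iff m).2 hσs).sum_le_tsum _ fun l _ => hσ0 _
  have hbdd : ∀ x, BddAbove (range fun N => birkhoffSum F L N x) := fun x =>
    ⟨φ 0 x + T 0, by rintro _ ⟨N, rfl⟩; exact hle 0 x N⟩
  have hψ : ∀ x N, birkhoffSum F L N x ≤ ⨆ N, birkhoffSum F L N x := fun x N => le_ciSup (hbdd x) N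
  refine ⟨fun x => ⨆ N, birkhoffSum F L N x, ?_, fun x => ?_, fun x => ?_⟩
  · refine continuous_of_uniform_approx_of_continuous ?_
    rw [Metric.uniformity_basis_dist_le.forall_iff (by
      rintro u v huv ⟨g, hg, hgu⟩
      exact ⟨g, hg, fun y => huv (hgu y)⟩)]
    intro ε hε
    obtain ⟨m, hm⟩ := (hT0.eventually (eventually_le_nhds hε)).exists
    refine ⟨φ m, Continuous.finset_sup'_apply _ fun i _ => hd.continuous_birkhoffSum i, fun y => ?_⟩
    have h1 : (⨆ N, birkhoffSum F L N y) ≤ φ m y + T m := ciSup_le (hle m y)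
    have h2 : φ m y ≤ ⨆ N, birkhoffSum F L N y := Finset.sup'_le _ _ fun i _ => hψ y i
    change dist (⨆ N, birkhoffSum F L N y) (φ m y) ≤ ε
    rw [Real.dist_eq, abs_le]
    constructor <;> linarith
  · refine iSup_congr fun N => ?_
    have := h.birkhoffSum_sub_int hd.periodic N (x + 1) 1
    rwa [Int.cast_one, add_sub_cancel_right, eq_comm] at this
  · have hsucc : ∀ N, birkhoffSum F L (N + 1) x ≤ (⨆ N, birkhoffSum F L N (F x)) + L x :=
      fun N => by
        rw [birkhoffSum_succ']
        linarith [hψ (F x) N]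
    refine le_antisymm (le_sub_iff_add_le.1 (ciSup_le fun N => ?_)) (ciSup_le fun N => ?_)
    · have := hψ x (N + 1)
      rw [birkhoffSum_succ'] at this
      linarith
    · cases N with
      | zero =>
        have hlim : Tendsto (fun n => birkhoffSum F L (q n) x) atTop (𝓝 0) :=
          squeeze_zero_norm (fun n => hσ n x) hσs.tendsto_atTop_zero
        rw [birkhoffSum_zero]
        refine le_of_tendsto' hlim fun n => ?_
        have := hsucc (q n - 1)
        rwa [Nat.sub_add_cancel (hc.pos n)] at this
      | succ N => exact hsucc N

/-- A continuous transfer function for the log-derivative integrates to a `C¹` conjugacy. -/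
theorem exists_conjugacy_of_transfer {ψ : ℝ → ℝ} (h : IrrationalLift F ρ)
    (hF : ∀ x, HasDerivAt F (Real.exp (L x)) x) (hcont : Continuous ψ)
    (hper : ∀ x, ψ (x + 1) = ψ x) (htr : ∀ x, ψ (F x) + L x = ψ x) :
    ∃ Φ Φ' : ℝ → ℝ, Continuous Φ' ∧ (∀ x, 0 < Φ' x) ∧ (∀ x, HasDerivAt Φ (Φ' x) x) ∧
      (∀ x, Φ (x + 1) = Φ x + 1) ∧ ∀ x, Φ (F x) = Φ x + ρ := by
  have hexp : Continuous fun x => Real.exp (ψ x) := Real.continuous_exp.comp hcont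
  have hI : 0 < ∫ t in (0 : ℝ)..1, Real.exp (ψ t) :=
    intervalIntegral.intervalIntegral_pos_of_pos (hexp.intervalIntegrable 0 1)
      (fun x => Real.exp_pos _) one_pos
  set I := ∫ t in (0 : ℝ)..1, Real.exp (ψ t) with hIdef
  set Φ : ℝ → ℝ := fun x => (∫ t in (0 : ℝ)..x, Real.exp (ψ t)) / I with hΦ
  have hderiv : ∀ x, HasDerivAt Φ (Real.exp (ψ x) / I) x := fun x =>
    (hexp.integral_hasStrictDerivAt 0 x).hasDerivAt.div_const I
  have hpos : ∀ x, 0 < Real.exp (ψ x) / I := fun x => div_pos (Real.exp_pos _) hI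
  have hΦ1 : ∀ x, Φ (x + 1) = Φ x + 1 := fun x => by
    have hp : Function.Periodic (fun x => Real.exp (ψ x)) 1 := fun x => by simp only [hper]
    have h1 := hp.intervalIntegral_add_eq x 0
    rw [zero_add, ← hIdef] at h1
    simp only [hΦ]
    rw [← intervalIntegral.integral_add_adjacent_intervals (hexp.intervalIntegrable 0 x)
      (hexp.intervalIntegrable x (x + 1)), h1, add_div, div_self hI.ne']
  have hmono := strictMono_of_hasDerivAt_pos hderiv hpos
  have hdiff : ∀ x, HasDerivAt (fun x => Φ (F x) - Φ x) 0 x := fun x => by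
    have h1 := ((hderiv (F x)).comp x (hF x)).sub (hderiv x)
    rwa [div_mul_eq_mul_div, ← Real.exp_add, htr, sub_self] at h1
  have hconst : ∀ x, Φ (F x) = Φ x + (Φ (F 0) - Φ 0) := fun x => by
    have := is_const_of_deriv_eq_zero (fun x => (hdiff x).differentiableAt)
      (fun x => (hdiff x).deriv) x 0
    linarith
  refine ⟨Φ, fun x => Real.exp (ψ x) / I, hexp.div_const I, hpos, hderiv, hΦ1, fun x => ?_⟩
  let f : CircleDeg1Lift := ⟨⟨F, h.strictMono.monotone⟩, h.map_add_one⟩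
  let g : CircleDeg1Lift := ⟨⟨Φ, hmono.monotone⟩, hΦ1⟩
  have hτ : CircleDeg1Lift.translationNumber f = ρ := by
    refine tendsto_nhds_unique (f.tendsto_translationNumber 0) ?_
    simp only [CircleDeg1Lift.coe_pow]
    exact h.tendsto 0
  have hsemi : Function.Semiconj g f
      (CircleDeg1Lift.translate (Multiplicative.ofAdd (Φ (F 0) - Φ 0))) := fun y => by
    rw [CircleDeg1Lift.translate_apply, add_comm]
    exact hconst y
  have := CircleDeg1Lift.translationNumber_eq_of_semiconj hsemi
  rw [hτ, CircleDeg1Lift.translationNumber_translate] at this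
  rw [this]
  exact hconst x

end Transfer

end

/-- Constant-type rotation numbers: if `sup_n kₙ < ∞` and `ϖ` satisfies the Dini
condition `∫₀¹ ϖ(y)/y dy < ∞`, then the `C_{2,ϖ}` diffeomorphism `T` admits a
`C¹` conjugacy to `R_ρ`. -/
theorem C1_conjugacy_constant_type
    (w : ℝ → ℝ) (hw : IsModulus w)
    (F F' F'' : ℝ → ℝ) (hF : StrictMono F) (hFp : ∀ x, F (x + 1) = F x + 1)
    (hF' : ∀ x, HasDerivAt F (F' x) x) (hF'' : ∀ x, HasDerivAt F' (F'' x) x)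
    (hF'pos : ∀ x, 0 < F' x)
    (hmod : ∀ x y : ℝ, x ≠ y → |F'' x - F'' y| ≤ w |x - y|)
    (ρ : ℝ) (hρ : ρ ∈ Set.Ioo (0:ℝ) 1) (hirr : Irrational ρ)
    (hrot : ∀ x : ℝ,
      Filter.Tendsto (fun n : ℕ => (F^[n] x - x) / (n : ℝ)) Filter.atTop (nhds ρ))
    (k p q : ℕ → ℕ) (hk : ∀ n, 1 ≤ k (n + 1))
    (hp0 : p 0 = 0) (hp1 : p 1 = 1) (hq0 : q 0 = 1) (hq1 : q 1 = k 1)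
    (hprec : ∀ n, p (n + 2) = k (n + 2) * p (n + 1) + p n)
    (hqrec : ∀ n, q (n + 2) = k (n + 2) * q (n + 1) + q n)
    (hconv : Filter.Tendsto (fun n => (p n : ℝ) / (q n : ℝ)) Filter.atTop (nhds ρ))
    (K : ℕ) (hK : ∀ n : ℕ, 1 ≤ n → k n ≤ K)
    (hDini : MeasureTheory.IntegrableOn (fun y : ℝ => w y / y) (Set.Ioc 0 1)) :
    ∃ Φ Φ' : ℝ → ℝ, Continuous Φ' ∧ (∀ x, 0 < Φ' x) ∧
      (∀ x, HasDerivAt Φ (Φ' x) x) ∧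
      (∀ x, Φ (x + 1) = Φ x + 1) ∧
      (∀ x, Φ (F x) = Φ x + ρ) := by
  have h : IrrationalLift F ρ := ⟨hF, hFp, hirr, hrot⟩
  have hc := isConvergents_of_recursion hirr hk hp0 hp1 hq0 hq1 hprec hqrec hconv
  obtain ⟨G, C, hd⟩ := exists_hasDistortionBounds hw hFp hF' hF'' hF'pos hmod
  have hq : ∀ n, q (n + 1) ≤ (K + 1) * q n := by
    intro n
    cases n with
    | zero =>
      rw [zero_add, hq0, hq1]
      linarith [hK 1 le_rfl]
    | succ n =>
      have hle : q n ≤ q (n + 1) := by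
        cases n with
        | zero => linarith [hk 0]
        | succ n => exact hc.le_succ_of_pos n
      rw [hqrec]
      nlinarith [hK (n + 2) (by omega)]
  obtain ⟨σ, hσs, hσ0, hσ⟩ := exists_summable_abs_birkhoffSum_le h hc hd hw hDini
  obtain ⟨ψ, hψ, hper, htr⟩ := exists_continuous_transfer h hc hd hq hσs hσ0 hσ
  exact exists_conjugacy_of_transfer h hd.hasDerivAt hψ hper htr
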